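/- Define Δ^ω := {α^ω : α ∈ Δ, α₀ ∉ O(α)}. Then Δ^ω is a basis of the root system Φ_re^ω in E^ω: Δ^ω is a linearly independent subset of E^ω that spans E^ω, every v ∈ Φ_re^ω is a linear combination of Δ^ω whose coefficients are all nonnegative integers or all nonpositive integers, and u/2 ∉ Φ_re^ω for every u ∈ Δ^ω. -/

import Mathlib

open scoped RealInnerProductSpace

namespace Folding

variable {E : Type*} [NormedAddCommGroup E] [InnerProductSpace ℝ E]

/-- The coroot `α^∨ = 2α/(α,α)` of a nonzero vector `α`. -/
noncomputable def coroot (α : E) : E := (2 / ⟪α, α⟫) • α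

/-- The reflection `s_α(x) = x - (α^∨, x) α`. -/
noncomputable def reflVec (α x : E) : E := x - ⟪coroot α, x⟫ • α

/-- `Φ` is a (finite, not necessarily reduced) root system in `E`. -/
def IsRootSystem (Φ : Set E) : Prop :=
  Φ.Finite ∧ (0 : E) ∉ Φ ∧ Submodule.span ℝ Φ = ⊤ ∧
    (∀ α ∈ Φ, ∀ β ∈ Φ, reflVec α β ∈ Φ) ∧
    ∀ α ∈ Φ, ∀ β ∈ Φ, ∃ n : ℤ, ⟪coroot α, β⟫ = (n : ℝ)

/-- `Φ` is reduced: no root is half of another root. -/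
def IsReducedRS (Φ : Set E) : Prop := ∀ α ∈ Φ, (2⁻¹ : ℝ) • α ∉ Φ

/-- `Φ` is irreducible: nonempty and not a disjoint union of two nonempty
mutually orthogonal subsets. -/
def IsIrreducibleRS (Φ : Set E) : Prop :=
  Φ.Nonempty ∧
    ¬∃ Φ₁ Φ₂ : Set E, Φ₁.Nonempty ∧ Φ₂.Nonempty ∧ Φ₁ ∪ Φ₂ = Φ ∧ Disjoint Φ₁ Φ₂ ∧
      ∀ u ∈ Φ₁, ∀ v ∈ Φ₂, ⟪u, v⟫ = 0

/-- `Δ` is a basis (a set of simple roots) of the root system `Φ`: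
it is a vector space basis of `E`, and every root is a linear combination of `Δ`
whose coefficients are all nonnegative integers or all nonpositive integers. -/
def IsBaseRS (Φ : Set E) (Δ : Finset E) : Prop :=
  ↑Δ ⊆ Φ ∧ LinearIndependent ℝ (fun α : {x : E // x ∈ Δ} => (α : E)) ∧
    Submodule.span ℝ (Δ : Set E) = ⊤ ∧
    ∀ β ∈ Φ, ∃ c : E → ℤ, ((∀ α, 0 ≤ c α) ∨ (∀ α, c α ≤ 0)) ∧
      β = ∑ α ∈ Δ, (c α : ℝ) • α

/-- `ω` belongs to the Weyl group of `Φ`: it is a product of reflections in roots. -/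
def InWeylGroup (Φ : Set E) (ω : E ≃ₗᵢ[ℝ] E) : Prop :=
  ∃ l : List E, (∀ α ∈ l, α ∈ Φ) ∧ ∀ x : E, ω x = l.foldr reflVec x

/-- The average `x^ω = (1/o(ω)) Σ_{t=1}^{o(ω)} ω^t(x)`, where `o(ω)` is the order of `ω`. -/
noncomputable def avg (ω : E ≃ₗᵢ[ℝ] E) (x : E) : E :=
  (orderOf ω : ℝ)⁻¹ • ∑ t ∈ Finset.range (orderOf ω), (ω ^ (t + 1)) x

/-- The fixed-point set `E^ω`. -/
def fixedSet (ω : E ≃ₗᵢ[ℝ] E) : Set E := {x | ω x = x}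

/-- The fixed-point subspace `E^ω`. -/
def fixedSubmodule (ω : E ≃ₗᵢ[ℝ] E) : Submodule ℝ E :=
  LinearMap.ker ((ω.toLinearEquiv : E →ₗ[ℝ] E) - LinearMap.id)

/-- The folded root system `Φ_re^ω = {β^ω : β ∈ Φ, β^ω ≠ 0}`. -/
noncomputable def foldedRoots (Φ : Set E) (ω : E ≃ₗᵢ[ℝ] E) : Set E :=
  {v | v ≠ 0 ∧ ∃ β ∈ Φ, avg ω β = v}

/-- The `⟨ω⟩`-orbit `O(β) = {ω^t(β) : t ∈ ℤ}`. -/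
def orbitOf (ω : E ≃ₗᵢ[ℝ] E) (β : E) : Set E := {γ | ∃ t : ℤ, (ω ^ t) β = γ}

/-- `N(β) = {γ ∈ O(β) : γ ≠ ±β, (β,γ) ≠ 0}`. -/
def nbrOf (ω : E ≃ₗᵢ[ℝ] E) (β : E) : Set E :=
  {γ | γ ∈ orbitOf ω β ∧ γ ≠ β ∧ γ ≠ -β ∧ ⟪β, γ⟫ ≠ 0}


/-- `Δ^ω`: the averages of the simple roots whose `⟨ω⟩`-orbit avoids `α₀ = -htilde`. -/
noncomputable def simpleAvg (Δ : Finset E) (htilde : E) (ω : E ≃ₗᵢ[ℝ] E) : Set E :=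
  {v | ∃ α ∈ (Δ : Set E), -htilde ∉ orbitOf ω α ∧ avg ω α = v}

/-- `π̄_S = (Σ_{α ∈ S} ϖ_α^∨)^ω` for a subset `S` of `Δ₀`. -/
noncomputable def pibar (ω : E ≃ₗᵢ[ℝ] E) (ϖ : E → E) (S : Set E) : E :=
  avg ω (∑ᶠ γ ∈ S, ϖ γ)

end Folding

namespace Folding

section RootSystems

variable {E : Type*} [NormedAddCommGroup E] [InnerProductSpace ℝ E] {Φ : Set E}

theorem inner_coroot (α x : E) : ⟪coroot α, x⟫ = 2 / ⟪α, α⟫ * ⟪α, x⟫ := by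
  simp [coroot, real_inner_smul_left]

theorem inner_coroot_mul {α : E} (hα : α ≠ 0) (x : E) :
    ⟪coroot α, x⟫ * ⟪α, α⟫ = 2 * ⟪α, x⟫ := by
  have : ⟪α, α⟫ ≠ 0 := inner_self_ne_zero.2 hα
  rw [inner_coroot]; field_simp

theorem inner_coroot_self {α : E} (hα : α ≠ 0) : ⟪coroot α, α⟫ = 2 := by
  have : ⟪α, α⟫ ≠ 0 := inner_self_ne_zero.2 hα
  rw [inner_coroot]; field_simp

theorem inner_coroot_pos {α x : E} (h : 0 < ⟪α, x⟫) : 0 < ⟪coroot α, x⟫ := by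
  have hα : α ≠ 0 := by rintro rfl; simp at h
  have : 0 < ⟪α, α⟫ := real_inner_self_pos.2 hα
  rw [inner_coroot]; positivity

theorem coroot_neg (α : E) : coroot (-α) = -coroot α := by
  simp [coroot]

namespace IsRootSystem

variable (h : IsRootSystem Φ) {α β : E}
include h

theorem finite : Φ.Finite := h.1

theorem ne_zero (hα : α ∈ Φ) : α ≠ 0 := by
  rintro rfl; exact h.2.1 hα

theorem span_eq_top : Submodule.span ℝ Φ = ⊤ := h.2.2.1

theorem inner_self_pos (hα : α ∈ Φ) : 0 < ⟪α, α⟫ := real_inner_self_pos.2 (h.ne_zero hα)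

theorem sub_smul_mem (hα : α ∈ Φ) (hβ : β ∈ Φ) : β - ⟪coroot α, β⟫ • α ∈ Φ :=
  h.2.2.2.1 α hα β hβ

theorem exists_int (hα : α ∈ Φ) (hβ : β ∈ Φ) : ∃ n : ℤ, ⟪coroot α, β⟫ = n :=
  h.2.2.2.2 α hα β hβ

theorem neg_mem (hα : α ∈ Φ) : -α ∈ Φ := by
  have := h.sub_smul_mem hα hα
  rwa [inner_coroot_self (h.ne_zero hα), two_smul, sub_add_cancel_left] at this

theorem sub_mem (hα : α ∈ Φ) (hβ : β ∈ Φ) (hne : α ≠ β) (hpos : 0 < ⟪α, β⟫) :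
    α - β ∈ Φ := by
  obtain ⟨p, hp⟩ := h.exists_int hα hβ
  obtain ⟨q, hq⟩ := h.exists_int hβ hα
  have hpos' : 0 < ⟪β, α⟫ := by rwa [real_inner_comm]
  have hp0 := inner_coroot_pos hpos
  have hq0 := inner_coroot_pos hpos'
  have e1 := inner_coroot_mul (h.ne_zero hα) β
  have e2 := inner_coroot_mul (h.ne_zero hβ) α
  rw [hp] at hp0 e1
  rw [hq] at hq0 e2
  rw [real_inner_comm α β] at e2
  have hp1 : 1 ≤ p := by exact_mod_cast hp0
  have hq1 : 1 ≤ q := by exact_mod_cast hq0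
  rcases hp1.eq_or_lt with hp1 | hp1
  · have := h.neg_mem (h.sub_smul_mem hα hβ)
    rwa [hp, ← hp1, Int.cast_one, one_smul, neg_sub] at this
  rcases hq1.eq_or_lt with hq1 | hq1
  · have := h.sub_smul_mem hβ hα
    rwa [hq, ← hq1, Int.cast_one, one_smul] at this
  exfalso
  have hp2 : (2 : ℝ) ≤ p := by exact_mod_cast hp1
  have hq2 : (2 : ℝ) ≤ q := by exact_mod_cast hq1
  have ha := h.inner_self_pos hα
  have hb := h.inner_self_pos hβ
  have hsub : 0 < ⟪α - β, α - β⟫ := real_inner_self_pos.2 (sub_ne_zero.2 hne)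
  rw [inner_sub_left, inner_sub_right, inner_sub_right, real_inner_comm α β] at hsub
  nlinarith [mul_nonneg (sub_nonneg.2 hp2) ha.le, mul_nonneg (sub_nonneg.2 hq2) hb.le]

end IsRootSystem

variable [FiniteDimensional ℝ E]

/-- The reflection `s_α` as a linear isometry. -/
noncomputable def refl (α : E) : E ≃ₗᵢ[ℝ] E := (ℝ ∙ α)ᗮ.reflection

theorem refl_apply (α x : E) : refl α x = x - ⟪coroot α, x⟫ • α := by
  rw [refl, Submodule.reflection_orthogonal_apply, Submodule.reflection_singleton_apply,
    inner_coroot]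
  simp only [RCLike.ofReal_real_eq_id, id, ← real_inner_self_eq_norm_sq]
  rw [neg_sub, ← Nat.cast_smul_eq_nsmul ℝ, smul_smul]
  congr 2
  push_cast
  ring

theorem refl_mul_self (α : E) : refl α * refl α = 1 := by
  exact Submodule.reflection_mul_reflection _

theorem refl_inv (α : E) : (refl α)⁻¹ = refl α :=
  inv_eq_of_mul_eq_one_left (refl_mul_self α)

theorem refl_refl (α x : E) : refl α (refl α x) = x :=
  Submodule.reflection_involutive _ x

theorem refl_self {α : E} (hα : α ≠ 0) : refl α α = -α := by
  rw [refl_apply, inner_coroot_self hα, two_smul]; abel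

theorem refl_of_inner_eq_zero {α x : E} (h : ⟪α, x⟫ = 0) : refl α x = x := by
  rw [refl_apply, inner_coroot, h]; simp

theorem refl_conj (g : E ≃ₗᵢ[ℝ] E) (α : E) : refl (g α) = g * refl α * g⁻¹ := by
  ext x
  obtain ⟨y, rfl⟩ := g.surjective x
  have : g⁻¹ (g y) = y := g.symm_apply_apply y
  simp only [LinearIsometryEquiv.coe_mul, Function.comp_apply, this, refl_apply, inner_coroot,
    map_sub, map_smul, LinearIsometryEquiv.inner_map_map]

/-- The group generated by the reflections in the elements of `S`. -/
def reflGroup (S : Set E) : Subgroup (E ≃ₗᵢ[ℝ] E) := Subgroup.closure (refl '' S)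

theorem refl_mem_reflGroup {S : Set E} {α : E} (hα : α ∈ S) : refl α ∈ reflGroup S :=
  Subgroup.subset_closure ⟨α, hα, rfl⟩

theorem reflGroup_mono {S T : Set E} (hST : S ⊆ T) : reflGroup S ≤ reflGroup T :=
  Subgroup.closure_mono (Set.image_mono hST)

theorem exists_list_of_mem_reflGroup {S : Set E} {g : E ≃ₗᵢ[ℝ] E} (hg : g ∈ reflGroup S) :
    ∃ l : List E, (∀ α ∈ l, α ∈ S) ∧ (l.map refl).prod = g := by
  induction hg using Subgroup.closure_induction with
  | mem x hx =>
    obtain ⟨α, hα, rfl⟩ := hx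
    exact ⟨[α], by simpa using hα, by simp⟩
  | one => exact ⟨[], by simp, by simp⟩
  | mul x y _ _ hx hy =>
    obtain ⟨l, hl, rfl⟩ := hx
    obtain ⟨l', hl', rfl⟩ := hy
    refine ⟨l ++ l', fun α hα => ?_, by simp⟩
    rcases List.mem_append.1 hα with h | h
    exacts [hl α h, hl' α h]
  | inv x _ hx =>
    obtain ⟨l, hl, rfl⟩ := hx
    refine ⟨l.reverse, fun α hα => hl α (List.mem_reverse.1 hα), ?_⟩
    rw [List.prod_inv_reverse, List.map_map]
    simp [refl_inv, Function.comp_def]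

theorem list_prod_mem_reflGroup {S : Set E} {l : List E} (hl : ∀ α ∈ l, α ∈ S) :
    (l.map refl).prod ∈ reflGroup S := by
  refine Subgroup.list_prod_mem _ fun x hx => ?_
  obtain ⟨α, hα, rfl⟩ := List.mem_map.1 hx
  exact refl_mem_reflGroup (hl α hα)

theorem inner_inv_apply (g : E ≃ₗᵢ[ℝ] E) (x y : E) : ⟪g⁻¹ x, y⟫ = ⟪x, g y⟫ := by
  rw [← g.inner_map_map (g⁻¹ x) y]
  exact congrArg (fun z => ⟪z, g y⟫) (g.apply_symm_apply x)

namespace IsRootSystem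

variable (h : IsRootSystem Φ) {α β : E}
include h

theorem refl_mem (hα : α ∈ Φ) (hβ : β ∈ Φ) : refl α β ∈ Φ := by
  rw [refl_apply]; exact h.sub_smul_mem hα hβ

theorem map_mem {g : E ≃ₗᵢ[ℝ] E} (hg : g ∈ reflGroup Φ) (hβ : β ∈ Φ) : g β ∈ Φ := by
  obtain ⟨l, hl, rfl⟩ := exists_list_of_mem_reflGroup hg
  clear hg
  induction l with
  | nil => simpa
  | cons a l ih =>
    simp only [List.map_cons, List.prod_cons, LinearIsometryEquiv.coe_mul, Function.comp_apply]
    exact h.refl_mem (hl a (by simp)) (ih fun α hα => hl α (by simp [hα]))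

theorem ext_of_eqOn {f g : E ≃ₗᵢ[ℝ] E} (hfg : ∀ β ∈ Φ, f β = g β) : f = g := by
  have : (f.toLinearEquiv : E →ₗ[ℝ] E) = g.toLinearEquiv :=
    LinearMap.ext_on h.span_eq_top hfg
  ext x
  exact LinearMap.congr_fun this x

theorem finite_reflGroup : Finite (reflGroup Φ) := by
  have := h.finite.to_subtype
  refine Finite.of_injective
    (fun (g : reflGroup Φ) (β : Φ) => (⟨g.1 β, h.map_mem g.2 β.2⟩ : Φ)) ?_
  intro f g hfg
  refine Subtype.ext (h.ext_of_eqOn fun β hβ => ?_)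
  exact congrArg Subtype.val (congrFun hfg ⟨β, hβ⟩)

theorem orderOf_pos_of_mem {g : E ≃ₗᵢ[ℝ] E} (hg : g ∈ reflGroup Φ) : 0 < orderOf g := by
  have := h.finite_reflGroup
  rw [← Subgroup.orderOf_mk g hg]
  exact orderOf_pos _

end IsRootSystem

theorem InWeylGroup.mem_reflGroup {ω : E ≃ₗᵢ[ℝ] E} (hω : InWeylGroup Φ ω) :
    ω ∈ reflGroup Φ := by
  obtain ⟨l, hl, hω⟩ := hω
  have : ω = (l.map refl).prod := by
    ext x
    rw [hω]
    clear hω hl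
    induction l with
    | nil => simp
    | cons a l ih => simp [ih, refl_apply, reflVec]
  rw [this]
  exact list_prod_mem_reflGroup hl

end RootSystems

end Folding

namespace Folding

section Bases

variable {E : Type*} [NormedAddCommGroup E] [InnerProductSpace ℝ E] {Φ : Set E} {Δ : Finset E}

namespace IsBaseRS

/-- The vector space basis underlying a base of a root system. -/
noncomputable def basis (h : IsBaseRS Φ Δ) : Module.Basis {x : E // x ∈ Δ} ℝ E :=
  Module.Basis.mk h.2.1 (by
    have : Set.range (fun α : {x : E // x ∈ Δ} => (α : E)) = (Δ : Set E) := by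
      ext x; simp
    rw [this, h.2.2.1])

open Classical in
/-- The coordinate functional of a simple root, extended by zero. -/
noncomputable def coord (h : IsBaseRS Φ Δ) (α : E) : E →ₗ[ℝ] ℝ :=
  if hα : α ∈ Δ then h.basis.coord ⟨α, hα⟩ else 0

/-- The height functional. -/
noncomputable def ht (h : IsBaseRS Φ Δ) : E →ₗ[ℝ] ℝ := ∑ α ∈ Δ, h.coord α

variable (h : IsBaseRS Φ Δ) {α β : E}
include h

theorem mem (hα : α ∈ Δ) : α ∈ Φ := h.1 hα

theorem ht_apply (x : E) : h.ht x = ∑ α ∈ Δ, h.coord α x := by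
  simp [ht]

theorem coord_self (hα : α ∈ Δ) : h.coord α α = 1 := by
  have : h.basis ⟨α, hα⟩ = α := by simp [basis]
  simp only [coord, hα, dif_pos]
  calc h.basis.coord ⟨α, hα⟩ α = h.basis.coord ⟨α, hα⟩ (h.basis ⟨α, hα⟩) := by rw [this]
    _ = 1 := by simp [-Module.Basis.coe_mk]

theorem coord_of_ne (hβ : β ∈ Δ) (hne : α ≠ β) : h.coord α β = 0 := by
  by_cases hα : α ∈ Δ
  · have : h.basis ⟨β, hβ⟩ = β := by simp [basis]
    simp only [coord, hα, dif_pos]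
    rw [← this]
    rw [Module.Basis.coord_apply, Module.Basis.repr_self, Finsupp.single_eq_of_ne]
    simpa using hne
  · simp [coord, hα]

theorem coord_sum (c : E → ℝ) (hα : α ∈ Δ) : h.coord α (∑ β ∈ Δ, c β • β) = c α := by
  rw [map_sum, Finset.sum_eq_single α]
  · rw [map_smul, h.coord_self hα, smul_eq_mul, mul_one]
  · intro β hβ hne
    rw [map_smul, h.coord_of_ne hβ hne.symm, smul_zero]
  · exact fun h => absurd hα h

theorem sum_coord (x : E) : ∑ α ∈ Δ, h.coord α x • α = x := by
  have := h.basis.sum_repr x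
  rw [← Finset.sum_coe_sort]
  conv_rhs => rw [← this]
  refine Finset.sum_congr rfl fun α _ => ?_
  simp [coord, basis]

theorem ht_simple (hα : α ∈ Δ) : h.ht α = 1 := by
  rw [ht_apply, Finset.sum_eq_single α, h.coord_self hα]
  · exact fun β _ hne => h.coord_of_ne hα hne
  · exact fun h => absurd hα h

theorem exists_coord_eq_intCast (hβ : β ∈ Φ) (hα : α ∈ Δ) : ∃ n : ℤ, h.coord α β = n := by
  obtain ⟨c, -, hc⟩ := h.2.2.2 β hβ
  refine ⟨c α, ?_⟩
  rw [hc]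
  exact h.coord_sum (fun α => (c α : ℝ)) hα

theorem exists_ht_eq_intCast (hβ : β ∈ Φ) : ∃ n : ℤ, h.ht β = n := by
  choose! f hf using fun α (hα : α ∈ Δ) => h.exists_coord_eq_intCast hβ hα
  refine ⟨∑ α ∈ Δ, f α, ?_⟩
  rw [ht_apply, Int.cast_sum]
  exact Finset.sum_congr rfl hf

theorem coord_nonneg_or_nonpos (hβ : β ∈ Φ) :
    (∀ α ∈ Δ, 0 ≤ h.coord α β) ∨ (∀ α ∈ Δ, h.coord α β ≤ 0) := by
  obtain ⟨c, hs, hc⟩ := h.2.2.2 β hβ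
  have key : ∀ α ∈ Δ, h.coord α β = c α := fun α hα => by
    rw [hc]
    exact h.coord_sum (fun α => (c α : ℝ)) hα
  refine hs.imp (fun hs α hα => ?_) (fun hs α hα => ?_)
  · rw [key α hα]; exact_mod_cast hs α
  · rw [key α hα]; exact_mod_cast hs α

theorem eq_zero_of_coord (x : E) (hx : ∀ α ∈ Δ, h.coord α x = 0) : x = 0 := by
  rw [← h.sum_coord x]
  exact Finset.sum_eq_zero fun α hα => by rw [hx α hα, zero_smul]

theorem coord_nonneg (hβ : β ∈ Φ) (hpos : 0 < h.ht β) (hα : α ∈ Δ) : 0 ≤ h.coord α β := by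
  rcases h.coord_nonneg_or_nonpos hβ with h' | h'
  · exact h' α hα
  · rw [ht_apply] at hpos
    exact absurd (Finset.sum_nonpos h') hpos.not_ge

theorem coord_nonpos (hβ : β ∈ Φ) (hneg : h.ht β < 0) (hα : α ∈ Δ) : h.coord α β ≤ 0 := by
  rcases h.coord_nonneg_or_nonpos hβ with h' | h'
  · rw [ht_apply] at hneg
    exact absurd (Finset.sum_nonneg h') hneg.not_ge
  · exact h' α hα

theorem ht_pos_of_coord_pos (hβ : β ∈ Φ) (hα : α ∈ Δ) (hpos : 0 < h.coord α β) :
    0 < h.ht β := by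
  rcases h.coord_nonneg_or_nonpos hβ with h' | h'
  · rw [ht_apply]
    exact Finset.sum_pos' h' ⟨α, hα, hpos⟩
  · exact absurd (h' α hα) hpos.not_ge

theorem ht_neg_of_coord_neg (hβ : β ∈ Φ) (hα : α ∈ Δ) (hneg : h.coord α β < 0) :
    h.ht β < 0 := by
  rcases h.coord_nonneg_or_nonpos hβ with h' | h'
  · exact absurd (h' α hα) hneg.not_ge
  · rw [ht_apply]
    exact Finset.sum_neg' h' ⟨α, hα, hneg⟩

theorem inner_eq_sum (x y : E) : ⟪x, y⟫ = ∑ α ∈ Δ, h.coord α x * ⟪α, y⟫ := by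
  conv_lhs => rw [← h.sum_coord x]
  simp [sum_inner, real_inner_smul_left]

end IsBaseRS

/-- A reduced root system together with a base. -/
structure IsBased (Φ : Set E) (Δ : Finset E) : Prop where
  rs : IsRootSystem Φ
  red : IsReducedRS Φ
  base : IsBaseRS Φ Δ

namespace IsBased

variable (h : IsBased Φ Δ) {α β : E}
include h

theorem ht_ne_zero (hβ : β ∈ Φ) : h.base.ht β ≠ 0 := by
  intro h0
  refine h.rs.ne_zero hβ (h.base.eq_zero_of_coord β fun α hα => ?_)
  by_contra hne
  rcases lt_or_gt_of_ne hne with h' | h'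
  · exact (h.base.ht_neg_of_coord_neg hβ hα h').ne h0
  · exact (h.base.ht_pos_of_coord_pos hβ hα h').ne' h0

theorem one_le_ht (hβ : β ∈ Φ) (hpos : 0 < h.base.ht β) : 1 ≤ h.base.ht β := by
  obtain ⟨n, hn⟩ := h.base.exists_ht_eq_intCast hβ
  rw [hn] at hpos ⊢
  exact_mod_cast hpos

theorem inner_nonpos (hα : α ∈ Δ) (hβ : β ∈ Δ) (hne : α ≠ β) : ⟪α, β⟫ ≤ 0 := by
  by_contra! hpos
  refine h.ht_ne_zero (h.rs.sub_mem (h.base.mem hα) (h.base.mem hβ) hne hpos) ?_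
  rw [map_sub, h.base.ht_simple hα, h.base.ht_simple hβ, sub_self]

theorem exists_inner_pos (hβ : β ∈ Φ) (hpos : 0 < h.base.ht β) :
    ∃ α ∈ Δ, 0 < h.base.coord α β ∧ 0 < ⟪α, β⟫ := by
  by_contra! hcon
  have hb := h.rs.inner_self_pos hβ
  rw [h.base.inner_eq_sum] at hb
  refine absurd (Finset.sum_nonpos fun α hα => ?_) hb.not_ge
  rcases (h.base.coord_nonneg hβ hpos hα).eq_or_lt with h0 | h0
  · rw [← h0, zero_mul]
  · exact mul_nonpos_of_nonneg_of_nonpos h0.le (hcon α hα h0)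

variable [FiniteDimensional ℝ E]

omit h in
theorem ht_refl (hb : IsBaseRS Φ Δ) (hα : α ∈ Δ) (x : E) :
    hb.ht (refl α x) = hb.ht x - ⟪coroot α, x⟫ := by
  rw [refl_apply, map_sub, map_smul, hb.ht_simple hα, smul_eq_mul, mul_one]

theorem eq_of_ht_refl_neg (hα : α ∈ Δ) (hβ : β ∈ Φ) (hpos : 0 < h.base.ht β)
    (hneg : h.base.ht (refl α β) < 0) : β = α := by
  have hzero : ∀ γ ∈ Δ, γ ≠ α → h.base.coord γ β = 0 := by
    intro γ hγ hne
    have h1 := h.base.coord_nonneg hβ hpos hγ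
    have h2 := h.base.coord_nonpos (h.rs.refl_mem (h.base.mem hα) hβ) hneg hγ
    rw [refl_apply, map_sub, map_smul, h.base.coord_of_ne hα hne, smul_zero, sub_zero] at h2
    exact le_antisymm h2 h1
  have hβα : β = h.base.coord α β • α := by
    conv_lhs => rw [← h.base.sum_coord β]
    refine Finset.sum_eq_single α (fun γ hγ hne => ?_) (fun h => absurd hα h)
    rw [hzero γ hγ hne, zero_smul]
  obtain ⟨n, hn⟩ := h.base.exists_coord_eq_intCast hβ hα
  have hn0 := h.base.coord_nonneg hβ hpos hα
  rw [hn] at hβα hn0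
  obtain ⟨m, hm⟩ := h.rs.exists_int hβ (h.base.mem hα)
  have e := inner_coroot_mul (h.rs.ne_zero hβ) α
  have ha := h.rs.inner_self_pos (h.base.mem hα)
  have hnne : (n : ℝ) ≠ 0 := by
    intro h0
    rw [h0, zero_smul] at hβα
    exact h.rs.ne_zero hβ hβα
  rw [hm, hβα, real_inner_smul_left, real_inner_smul_left, real_inner_smul_right] at e
  have e2 : (m : ℝ) * n = 2 := by
    have : ((m : ℝ) * n - 2) * (n * ⟪α, α⟫) = 0 := by linear_combination e
    rcases mul_eq_zero.1 this with h' | h'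
    · linarith
    · exact absurd h' (mul_ne_zero hnne ha.ne')
  have e3 : m * n = 2 := by exact_mod_cast e2
  have hn1 : 0 ≤ n := by exact_mod_cast hn0
  have hdvd : n ∣ 2 := Dvd.intro_left m e3
  have hle := Int.le_of_dvd (by norm_num) hdvd
  have hcases : n = 0 ∨ n = 1 ∨ n = 2 := by omega
  rcases hcases with rfl | rfl | rfl
  · simp at hnne
  · simpa using hβα
  · refine absurd ?_ (h.red β hβ)
    rw [hβα, smul_smul]
    simpa using h.base.mem hα

theorem refl_mem_reflGroup_simple (n : ℕ) : ∀ β ∈ Φ, 0 < h.base.ht β → h.base.ht β < n →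
    refl β ∈ reflGroup (Δ : Set E) := by
  induction n with
  | zero => intro β _ h1 h2; exact absurd h1 (by simpa using h2.le)
  | succ n ih =>
    intro β hβ hpos hlt
    obtain ⟨α, hα, -, hin⟩ := h.exists_inner_pos hβ hpos
    have hsα : refl α ∈ reflGroup (Δ : Set E) := refl_mem_reflGroup hα
    by_cases hne : β = α
    · rwa [hne]
    have hmem := h.rs.refl_mem (h.base.mem hα) hβ
    have hp : 0 < h.base.ht (refl α β) := by
      rcases lt_or_gt_of_ne (h.ht_ne_zero hmem) with h' | h'
      · exact absurd (h.eq_of_ht_refl_neg hα hβ hpos h') hne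
      · exact h'
    have hc := inner_coroot_pos hin
    obtain ⟨k, hk⟩ := h.rs.exists_int (h.base.mem hα) hβ
    have hk1 : (1 : ℝ) ≤ k := by
      rw [hk] at hc
      exact_mod_cast hc
    have := ih (refl α β) hmem hp (by
      rw [ht_refl h.base hα, hk]
      push_cast at hlt
      linarith)
    rw [refl_conj] at this
    have h2 := mul_mem (mul_mem (inv_mem hsα) this) hsα
    simpa [mul_assoc] using h2

theorem reflGroup_simple : reflGroup (Δ : Set E) = reflGroup Φ := by
  refine le_antisymm (reflGroup_mono h.base.1) ?_
  refine (Subgroup.closure_le _).2 ?_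
  rintro _ ⟨β, hβ, rfl⟩
  have key : ∀ β ∈ Φ, 0 < h.base.ht β → refl β ∈ reflGroup (Δ : Set E) := fun β hβ hpos => by
    obtain ⟨n, hn⟩ := exists_nat_gt (h.base.ht β)
    exact h.refl_mem_reflGroup_simple n β hβ hpos hn
  rcases lt_or_gt_of_ne (h.ht_ne_zero hβ) with h' | h'
  · have := key (-β) (h.rs.neg_mem hβ) (by rw [map_neg]; linarith)
    have e : refl (-β) = refl β := by
      ext x
      simp [refl_apply, coroot_neg]
    rwa [e] at this
  · exact key β hβ h'

theorem exchange {l : List E} (hl : ∀ i ∈ l, i ∈ Δ) (hα : α ∈ Δ)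
    (hneg : h.base.ht ((l.map refl).prod α) < 0) :
    ∃ l' : List E, (∀ i ∈ l', i ∈ Δ) ∧ l'.length + 1 = l.length ∧
      (l.map refl).prod * refl α = (l'.map refl).prod := by
  induction l with
  | nil =>
    simp only [List.map_nil, List.prod_nil, LinearIsometryEquiv.coe_one, id_eq] at hneg
    rw [h.base.ht_simple hα] at hneg
    linarith
  | cons i t ih =>
    have ht : ∀ i ∈ t, i ∈ Δ := fun j hj => hl j (by simp [hj])
    have hi : i ∈ Δ := hl i (by simp)
    have hroot : (t.map refl).prod α ∈ Φ :=
      h.rs.map_mem (list_prod_mem_reflGroup fun j hj => h.base.mem (ht j hj)) (h.base.mem hα)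
    simp only [List.map_cons, List.prod_cons, LinearIsometryEquiv.coe_mul,
      Function.comp_apply] at hneg ⊢
    rcases lt_or_gt_of_ne (h.ht_ne_zero hroot) with h' | h'
    · obtain ⟨l', h1, h2, h3⟩ := ih ht h'
      refine ⟨i :: l', ?_, by simp [h2], ?_⟩
      · intro j hj
        rcases List.mem_cons.1 hj with rfl | hj
        exacts [hi, h1 j hj]
      · rw [mul_assoc, h3, List.map_cons, List.prod_cons]
    · have := h.eq_of_ht_refl_neg hi hroot h' hneg
      refine ⟨t, ht, rfl, ?_⟩
      rw [← this, refl_conj]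
      rw [mul_assoc, mul_assoc, mul_assoc, inv_mul_cancel_left, refl_mul_self, mul_one]

theorem list_prod_mem_of_dominant {y : E} (hy : ∀ α ∈ Δ, 0 ≤ ⟪α, y⟫) (n : ℕ) :
    ∀ l : List E, (∀ i ∈ l, i ∈ Δ) → l.length ≤ n → (l.map refl).prod y = y →
      (l.map refl).prod ∈ reflGroup {α | α ∈ Δ ∧ ⟪α, y⟫ = 0} := by
  induction n with
  | zero =>
    intro l _ hlen _
    rw [List.length_eq_zero_iff.1 (by omega : l.length = 0)]
    simp
  | succ n ih =>
    intro l hl hlen hfix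
    rcases List.eq_nil_or_concat l with rfl | ⟨t, α, rfl⟩
    · simp
    simp only [List.concat_eq_append] at *
    simp only [List.map_append, List.map_cons, List.map_nil, List.prod_append, List.prod_cons,
      List.prod_nil, mul_one, List.length_append, List.length_cons, List.length_nil] at *
    have hα : α ∈ Δ := hl α (by simp)
    have ht : ∀ i ∈ t, i ∈ Δ := fun i hi => hl i (by simp [hi])
    have hroot : (t.map refl).prod α ∈ Φ :=
      h.rs.map_mem (list_prod_mem_reflGroup fun j hj => h.base.mem (ht j hj)) (h.base.mem hα)
    rcases lt_or_gt_of_ne (h.ht_ne_zero hroot) with h' | h'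
    · obtain ⟨l', h1, h2, h3⟩ := h.exchange ht hα h'
      rw [h3] at hfix ⊢
      exact ih l' h1 (by omega) hfix
    · set g := (t.map refl).prod with hg
      have h1 : (0 : ℝ) ≤ ⟪g α, y⟫ := by
        rw [h.base.inner_eq_sum]
        exact Finset.sum_nonneg fun i hi =>
          mul_nonneg (h.base.coord_nonneg hroot h' hi) (hy i hi)
      have h2 : ⟪g α, y⟫ = -⟪α, y⟫ := by
        have e : (g * refl α) α = -g α := by
          simp [refl_self (h.rs.ne_zero (h.base.mem hα))]
        have := (g * refl α).inner_map_map α y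
        rw [hfix, e, inner_neg_left] at this
        linarith
      have h3 : ⟪α, y⟫ = 0 := le_antisymm (by linarith) (hy α hα)
      have h4 : g y = y := by
        have := hfix
        simp only [LinearIsometryEquiv.coe_mul, Function.comp_apply] at this
        rwa [refl_of_inner_eq_zero h3] at this
      exact mul_mem (ih t ht (by omega) h4) (refl_mem_reflGroup ⟨hα, h3⟩)

omit h in
theorem conj_mem_reflGroup {S T : Set E} {g u : E ≃ₗᵢ[ℝ] E} (hg : g ∈ reflGroup S)
    (hu : ∀ α ∈ S, u α ∈ T) : u * g * u⁻¹ ∈ reflGroup T := by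
  obtain ⟨l, hl, rfl⟩ := exists_list_of_mem_reflGroup hg
  clear hg
  induction l with
  | nil => simp
  | cons a l ih =>
    have h1 := ih fun α hα => hl α (by simp [hα])
    have h2 : refl (u a) ∈ reflGroup T := refl_mem_reflGroup (hu a (hl a (by simp)))
    rw [refl_conj] at h2
    simpa [mul_assoc] using mul_mem h2 h1

/-- An element of the Weyl group fixing `y` is a product of reflections fixing `y`. -/
theorem mem_reflGroup_of_fixed {ω : E ≃ₗᵢ[ℝ] E} (hω : ω ∈ reflGroup Φ) {y : E} (hy : ω y = y) :
    ω ∈ reflGroup {γ | γ ∈ Φ ∧ ⟪γ, y⟫ = 0} := by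
  have := h.rs.finite_reflGroup
  obtain ⟨⟨u, hu⟩, hmax⟩ := Finite.exists_max fun u : reflGroup Φ => h.base.ht (u.1 y)
  have hdom : ∀ α ∈ Δ, 0 ≤ ⟪α, u y⟫ := by
    intro α hα
    by_contra! hneg
    have h1 := hmax ⟨refl α * u, mul_mem (refl_mem_reflGroup (h.base.mem hα)) hu⟩
    simp only [LinearIsometryEquiv.coe_mul, Function.comp_apply] at h1
    rw [ht_refl h.base hα] at h1
    have h2 : 0 < ⟪coroot α, -u y⟫ := inner_coroot_pos (by rw [inner_neg_right]; linarith)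
    rw [inner_neg_right] at h2
    linarith
  have hmem : u * ω * u⁻¹ ∈ reflGroup (Δ : Set E) := by
    rw [h.reflGroup_simple]
    exact mul_mem (mul_mem hu hω) (inv_mem hu)
  obtain ⟨l, hl, hprod⟩ := exists_list_of_mem_reflGroup hmem
  have hfix : (u * ω * u⁻¹) (u y) = u y := by
    simp [hy]
  have := h.list_prod_mem_of_dominant hdom l.length l hl le_rfl (by rw [hprod, hfix])
  rw [hprod] at this
  have h2 := conj_mem_reflGroup (u := u⁻¹) (T := {γ | γ ∈ Φ ∧ ⟪γ, y⟫ = 0}) this ?_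
  · simpa [mul_assoc] using h2
  · rintro α ⟨hα, hα0⟩
    refine ⟨h.rs.map_mem (inv_mem hu) (h.base.mem hα), ?_⟩
    rw [inner_inv_apply, hα0]

end IsBased

end Bases

end Folding

namespace Folding

section HighestRoot

variable {E : Type*} [NormedAddCommGroup E] [InnerProductSpace ℝ E] {Φ : Set E} {Δ : Finset E}
  {θ : E}

theorem IsRootSystem.add_mem (h : IsRootSystem Φ) {α β : E} (hα : α ∈ Φ) (hβ : β ∈ Φ)
    (hne : β ≠ -α) (hneg : ⟪α, β⟫ < 0) : β + α ∈ Φ := by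
  have := h.sub_mem hβ (h.neg_mem hα) hne (by
    rw [inner_neg_right, real_inner_comm]
    linarith)
  rwa [sub_neg_eq_add] at this

/-- An irreducible reduced root system with a base and the corresponding highest root. -/
structure HasHighest (Φ : Set E) (Δ : Finset E) (θ : E) : Prop extends IsBased Φ Δ where
  irr : IsIrreducibleRS Φ
  mem : θ ∈ Φ
  ht_lt : ∀ β ∈ Φ, β ≠ θ → base.ht β < base.ht θ

namespace HasHighest

variable (h : HasHighest Φ Δ θ) {α β : E}
include h

theorem ht_le (hβ : β ∈ Φ) : h.base.ht β ≤ h.base.ht θ := by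
  by_cases hne : β = θ
  · rw [hne]
  · exact (h.ht_lt β hβ hne).le

theorem ht_pos : 0 < h.base.ht θ := by
  have hle := h.ht_le (h.rs.neg_mem h.mem)
  rw [map_neg] at hle
  have hne := h.ht_ne_zero h.mem
  have : 0 ≤ h.base.ht θ := by linarith
  exact lt_of_le_of_ne this hne.symm

theorem dominant (hα : α ∈ Δ) : 0 ≤ ⟪α, θ⟫ := by
  by_contra! hneg
  have hαΦ := h.base.mem hα
  have := h.rs.add_mem hαΦ h.mem (fun e => by
    have h2 := congrArg h.base.ht e
    rw [map_neg, h.base.ht_simple hα] at h2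
    linarith [h.ht_pos]) hneg
  have h3 := h.ht_le this
  rw [map_add, h.base.ht_simple hα] at h3
  linarith

theorem inner_eq_zero_of_support {i j : E} (hi : i ∈ Δ) (hj : j ∈ Δ)
    (hi0 : 0 < h.base.coord i θ) (hj0 : h.base.coord j θ = 0) : ⟪i, j⟫ = 0 := by
  have hdom := h.dominant hj
  rw [real_inner_comm, h.base.inner_eq_sum] at hdom
  have hterm : ∀ α ∈ Δ, h.base.coord α θ * ⟪α, j⟫ ≤ 0 := by
    intro α hα
    by_cases hne : α = j
    · rw [hne, hj0, zero_mul]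
    · exact mul_nonpos_of_nonneg_of_nonpos (h.base.coord_nonneg h.mem h.ht_pos hα)
        (h.inner_nonpos hα hj hne)
  have hz := (Finset.sum_eq_zero_iff_of_nonpos hterm).1
    (le_antisymm (Finset.sum_nonpos hterm) hdom) i hi
  exact (mul_eq_zero.1 hz).resolve_left hi0.ne'

theorem support_dichotomy (n : ℕ) : ∀ β ∈ Φ, 0 < h.base.ht β → h.base.ht β < n →
    (∀ i ∈ Δ, 0 < h.base.coord i θ → h.base.coord i β = 0) ∨
      (∀ j ∈ Δ, h.base.coord j θ = 0 → h.base.coord j β = 0) := by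
  induction n with
  | zero => intro β _ h1 h2; exact absurd h1 (by simpa using h2.le)
  | succ n ih =>
    intro β hβ hpos hlt
    obtain ⟨α, hα, -, hin⟩ := h.exists_inner_pos hβ hpos
    have hαΦ := h.base.mem hα
    by_cases hne : β = α
    · rcases (h.base.coord_nonneg h.mem h.ht_pos hα).eq_or_lt with h0 | h0
      · left
        intro i hi hi0
        rw [hne]
        exact h.base.coord_of_ne hα (by rintro rfl; linarith)
      · right
        intro j hj hj0
        rw [hne]
        exact h.base.coord_of_ne hα (by rintro rfl; linarith)
    have hγ : β - α ∈ Φ := h.rs.sub_mem hβ hαΦ hne (by rwa [real_inner_comm])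
    have hhtγ : h.base.ht (β - α) = h.base.ht β - 1 := by
      rw [map_sub, h.base.ht_simple hα]
    have hγpos : 0 < h.base.ht (β - α) := by
      have h1 := h.one_le_ht hβ hpos
      exact lt_of_le_of_ne (by linarith) (h.ht_ne_zero hγ).symm
    have hγ1 := h.one_le_ht hγ hγpos
    have key : ⟪α, β - α⟫ = 0 → h.base.coord α (β - α) ≠ 0 := by
      intro h0 hc
      have hm := h.rs.sub_smul_mem hαΦ hβ
      have e : ⟪coroot α, β⟫ = 2 := by
        have : β = (β - α) + α := by abel
        rw [this, inner_add_right, inner_coroot, h0, inner_coroot_self (h.rs.ne_zero hαΦ)]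
        ring
      rw [e] at hm
      have h1 : h.base.coord α (β - (2 : ℝ) • α) = -1 := by
        rw [map_sub, h.base.coord_self hα] at hc
        rw [map_sub, map_smul, h.base.coord_self hα, smul_eq_mul]
        linarith
      have h2 := h.base.ht_neg_of_coord_neg hm hα (by rw [h1]; norm_num)
      rw [map_sub, map_smul, h.base.ht_simple hα, smul_eq_mul] at h2
      linarith
    have hcoord : ∀ i, h.base.coord i β = h.base.coord i (β - α) + h.base.coord i α := by
      intro i; rw [map_sub]; ring
    rcases (h.base.coord_nonneg h.mem h.ht_pos hα).eq_or_lt with h0 | h0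
    · rcases ih _ hγ hγpos (by push_cast at hlt; linarith) with h1 | h1
      · left
        intro i hi hi0
        rw [hcoord, h1 i hi hi0, h.base.coord_of_ne hα (by rintro rfl; linarith), add_zero]
      · refine absurd (h1 α hα h0.symm) (key ?_)
        rw [real_inner_comm, h.base.inner_eq_sum]
        refine Finset.sum_eq_zero fun i hi => ?_
        rcases (h.base.coord_nonneg h.mem h.ht_pos hi).eq_or_lt with h2 | h2
        · rw [h1 i hi h2.symm, zero_mul]
        · rw [h.inner_eq_zero_of_support hi hα h2 h0.symm, mul_zero]
    · rcases ih _ hγ hγpos (by push_cast at hlt; linarith) with h1 | h1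
      · refine absurd (h1 α hα h0) (key ?_)
        rw [real_inner_comm, h.base.inner_eq_sum]
        refine Finset.sum_eq_zero fun i hi => ?_
        rcases (h.base.coord_nonneg h.mem h.ht_pos hi).eq_or_lt with h2 | h2
        · rw [real_inner_comm, h.inner_eq_zero_of_support hα hi h0 h2.symm, mul_zero]
        · rw [h1 i hi h2, zero_mul]
      · right
        intro i hi hi0
        rw [hcoord, h1 i hi hi0, h.base.coord_of_ne hα (by rintro rfl; linarith), add_zero]

theorem coord_pos (hα : α ∈ Δ) : 0 < h.base.coord α θ := by
  by_contra hcon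
  have hα0 : h.base.coord α θ = 0 :=
    le_antisymm (not_lt.1 hcon) (h.base.coord_nonneg h.mem h.ht_pos hα)
  refine h.irr.2 ⟨{β | β ∈ Φ ∧ ∀ j ∈ Δ, h.base.coord j θ = 0 → h.base.coord j β = 0},
    {β | β ∈ Φ ∧ ∀ i ∈ Δ, 0 < h.base.coord i θ → h.base.coord i β = 0},
    ⟨θ, h.mem, fun j _ hj => hj⟩, ⟨α, h.base.mem hα, fun i hi hi0 =>
      h.base.coord_of_ne hα (by rintro rfl; linarith)⟩, ?_, ?_, ?_⟩
  · ext β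
    refine ⟨fun hβ => hβ.elim (fun h' => h'.1) (fun h' => h'.1), fun hβ => ?_⟩
    have key : ∀ β ∈ Φ, 0 < h.base.ht β →
        (∀ i ∈ Δ, 0 < h.base.coord i θ → h.base.coord i β = 0) ∨
        (∀ j ∈ Δ, h.base.coord j θ = 0 → h.base.coord j β = 0) := by
      intro β hβ hpos
      obtain ⟨n, hn⟩ := exists_nat_gt (h.base.ht β)
      exact h.support_dichotomy n β hβ hpos hn
    rcases lt_or_gt_of_ne (h.ht_ne_zero hβ) with h' | h'
    · rcases key (-β) (h.rs.neg_mem hβ) (by rw [map_neg]; linarith) with h1 | h1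
      · exact Or.inr ⟨hβ, fun i hi hi0 => by simpa using h1 i hi hi0⟩
      · exact Or.inl ⟨hβ, fun i hi hi0 => by simpa using h1 i hi hi0⟩
    · rcases key β hβ h' with h1 | h1
      · exact Or.inr ⟨hβ, h1⟩
      · exact Or.inl ⟨hβ, h1⟩
  · rw [Set.disjoint_left]
    rintro β ⟨hβ, h1⟩ ⟨-, h2⟩
    refine h.rs.ne_zero hβ (h.base.eq_zero_of_coord β fun i hi => ?_)
    rcases (h.base.coord_nonneg h.mem h.ht_pos hi).eq_or_lt with h3 | h3
    · exact h1 i hi h3.symm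
    · exact h2 i hi h3
  · rintro u ⟨-, hu⟩ v ⟨-, hv⟩
    rw [h.base.inner_eq_sum]
    refine Finset.sum_eq_zero fun i hi => ?_
    rcases (h.base.coord_nonneg h.mem h.ht_pos hi).eq_or_lt with h3 | h3
    · rw [hu i hi h3.symm, zero_mul]
    · rw [real_inner_comm, h.base.inner_eq_sum, Finset.sum_eq_zero, mul_zero]
      intro j hj
      rcases (h.base.coord_nonneg h.mem h.ht_pos hj).eq_or_lt with h4 | h4
      · rw [real_inner_comm, h.inner_eq_zero_of_support hi hj h3 h4.symm, mul_zero]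
      · rw [hv j hj h4, zero_mul]

theorem coord_le_aux (n : ℕ) : ∀ β ∈ Φ, h.base.ht θ - h.base.ht β < n → ∀ α ∈ Δ,
    h.base.coord α β ≤ h.base.coord α θ := by
  induction n with
  | zero => intro β hβ h1; exact absurd (h.ht_le hβ) (by simpa using h1)
  | succ n ih =>
    intro β hβ hlt α hα
    by_cases hup : ∃ i ∈ Δ, β + i ∈ Φ
    · obtain ⟨i, hi, hmem⟩ := hup
      have h1 := ih (β + i) hmem (by
        rw [map_add, h.base.ht_simple hi]
        push_cast at hlt
        linarith) α hα
      have h2 := h.base.coord_nonneg (h.base.mem hi)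
        (by rw [h.base.ht_simple hi]; norm_num) hα
      rw [map_add] at h1
      linarith
    push Not at hup
    by_cases hneg : ∃ i ∈ Δ, β = -i
    · obtain ⟨i, hi, rfl⟩ := hneg
      have h1 := h.base.coord_nonpos hβ
        (by rw [map_neg, h.base.ht_simple hi]; norm_num) hα
      exact h1.trans (h.coord_pos hα).le
    push Not at hneg
    by_cases hθ : β = θ
    · rw [hθ]
    have hdom : ∀ i ∈ Δ, 0 ≤ ⟪i, β⟫ := by
      intro i hi
      by_contra! hlt0
      exact hup i hi (h.rs.add_mem (h.base.mem hi) hβ (hneg i hi) hlt0)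
    have hpos : 0 < ⟪θ, β⟫ := by
      have hnn : ∀ i ∈ Δ, 0 ≤ h.base.coord i θ * ⟪i, β⟫ := fun i hi =>
        mul_nonneg (h.coord_pos hi).le (hdom i hi)
      rw [h.base.inner_eq_sum]
      refine lt_of_le_of_ne (Finset.sum_nonneg hnn) fun h0 => ?_
      have hz := (Finset.sum_eq_zero_iff_of_nonneg hnn).1 h0.symm
      have := h.rs.inner_self_pos hβ
      rw [h.base.inner_eq_sum, Finset.sum_eq_zero] at this
      · exact lt_irrefl _ this
      · intro i hi
        rw [(mul_eq_zero.1 (hz i hi)).resolve_left (h.coord_pos hi).ne', mul_zero]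
    have hmem := h.rs.sub_mem h.mem hβ (Ne.symm hθ) hpos
    have h1 := h.base.coord_nonneg hmem (by
      rw [map_sub]
      linarith [h.ht_lt β hβ hθ]) hα
    rw [map_sub] at h1
    linarith

theorem coord_le (hβ : β ∈ Φ) (hα : α ∈ Δ) : h.base.coord α β ≤ h.base.coord α θ := by
  obtain ⟨n, hn⟩ := exists_nat_gt (h.base.ht θ - h.base.ht β)
  exact h.coord_le_aux n β hβ hn α hα

end HasHighest

/-- The lattice spanned by the coroots of the elements of `S`. -/
def corootLattice (S : Set E) : AddSubgroup E := AddSubgroup.closure (coroot '' S)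

theorem IsRootSystem.exists_list_of_mem_corootLattice (h : IsRootSystem Φ) {q : E}
    (hq : q ∈ corootLattice Φ) : ∃ l : List E, (∀ i ∈ l, i ∈ Φ) ∧ (l.map coroot).sum = q := by
  induction hq using AddSubgroup.closure_induction with
  | mem x hx =>
    obtain ⟨α, hα, rfl⟩ := hx
    exact ⟨[α], by simpa using hα, by simp⟩
  | zero => exact ⟨[], by simp, by simp⟩
  | add x y _ _ hx hy =>
    obtain ⟨l, hl, rfl⟩ := hx
    obtain ⟨l', hl', rfl⟩ := hy
    refine ⟨l ++ l', fun α hα => ?_, by simp⟩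
    rcases List.mem_append.1 hα with h | h
    exacts [hl α h, hl' α h]
  | neg x hmem hx =>
    obtain ⟨l, hl, rfl⟩ := hx
    refine ⟨l.map (fun x => -x), fun α hα => ?_, ?_⟩
    · obtain ⟨β, hβ, rfl⟩ := List.mem_map.1 hα
      exact h.neg_mem (hl β hβ)
    · clear hl hmem
      induction l with
      | nil => simp
      | cons a l ih =>
        simp only [List.map_cons, List.sum_cons, ih, coroot_neg]
        abel

theorem IsRootSystem.exists_int_inner_of_mem (h : IsRootSystem Φ) {q α : E}
    (hq : q ∈ corootLattice Φ) (hα : α ∈ Φ) : ∃ n : ℤ, ⟪α, q⟫ = n := by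
  induction hq using AddSubgroup.closure_induction with
  | mem x hx =>
    obtain ⟨β, hβ, rfl⟩ := hx
    rw [real_inner_comm]
    exact h.exists_int hβ hα
  | zero => exact ⟨0, by simp⟩
  | add x y _ _ hx hy =>
    obtain ⟨m, hm⟩ := hx
    obtain ⟨n, hn⟩ := hy
    exact ⟨m + n, by rw [inner_add_right, hm, hn]; simp⟩
  | neg x _ hx =>
    obtain ⟨m, hm⟩ := hx
    exact ⟨-m, by rw [inner_neg_right, hm]; simp⟩

variable [FiniteDimensional ℝ E]

theorem IsRootSystem.minuscule_list_sum_eq_zero (h : IsRootSystem Φ) (n : ℕ) : ∀ l : List E,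
    (∀ i ∈ l, i ∈ Φ) → l.length = n → (∀ α ∈ Φ, |⟪α, (l.map coroot).sum⟫| ≤ 1) →
      (l.map coroot).sum = 0 := by
  classical
  induction n with
  | zero =>
    intro l _ hlen _
    rw [List.length_eq_zero_iff.1 hlen]
    simp
  | succ n ih =>
    intro l hl hlen hmin
    set q := (l.map coroot).sum with hq
    by_contra hne
    have hqmem : q ∈ corootLattice Φ := by
      refine AddSubgroup.list_sum_mem _ fun x hx => ?_
      obtain ⟨α, hα, rfl⟩ := List.mem_map.1 hx
      exact AddSubgroup.subset_closure ⟨α, hl α hα, rfl⟩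
    obtain ⟨β, hβl, hβ⟩ : ∃ β ∈ l, 0 < ⟪coroot β, q⟫ := by
      by_contra! hcon
      have hqq : 0 < ⟪q, q⟫ := real_inner_self_pos.2 hne
      have key : ∀ (y : E) (l : List E), (∀ β ∈ l, ⟪coroot β, y⟫ ≤ 0) →
          ⟪(l.map coroot).sum, y⟫ ≤ 0 := by
        intro y l
        induction l with
        | nil => simp
        | cons a l ih =>
          intro hy
          rw [List.map_cons, List.sum_cons, inner_add_left]
          exact add_nonpos (hy a (by simp)) (ih fun β hβ => hy β (by simp [hβ]))
      exact absurd (key q l hcon) hqq.not_ge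
    have hβΦ := hl β hβl
    have hβpos := h.inner_self_pos hβΦ
    obtain ⟨m, hm⟩ := h.exists_int_inner_of_mem hqmem hβΦ
    have hm1 : m = 1 := by
      rw [inner_coroot, hm] at hβ
      have h1 : (0 : ℝ) < m := pos_of_mul_pos_right hβ (by positivity)
      have h2 := (abs_le.1 (hmin β hβΦ)).2
      rw [hm] at h2
      have h3 : 0 < m := by exact_mod_cast h1
      have h4 : m ≤ 1 := by exact_mod_cast h2
      omega
    have hs : refl β q = q - coroot β := by
      rw [refl_apply, inner_coroot, hm, hm1]
      simp [coroot]
    have hsum : ((l.erase β).map coroot).sum = refl β q := by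
      rw [hs, eq_sub_iff_add_eq, hq, add_comm]
      have := ((List.perm_cons_erase hβl).map coroot).sum_eq
      rw [this, List.map_cons, List.sum_cons]
    have h0 := ih (l.erase β) (fun i hi => hl i (List.mem_of_mem_erase hi))
      (by rw [List.length_erase_of_mem hβl, hlen]; rfl) (fun α hα => by
        rw [hsum, ← (refl β).inner_map_map, refl_refl]
        exact hmin _ (h.refl_mem hβΦ hα))
    rw [hsum] at h0
    exact hne ((refl β).map_eq_zero_iff.1 h0)

/-- A Weyl group element moving a point of the open fundamental alcove by an element of the
coroot lattice is trivial. -/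
theorem IsBased.eq_one_of_sub_mem (h : IsBased Φ Δ) {x : E} (hx : ∀ α ∈ Φ, |⟪α, x⟫| < 1)
    (hx0 : ∀ α ∈ Φ, ⟪α, x⟫ ≠ 0) {g : E ≃ₗᵢ[ℝ] E} (hg : g ∈ reflGroup Φ)
    (hsub : x - g x ∈ corootLattice Φ) : g = 1 := by
  obtain ⟨l, hl, hsum⟩ := h.rs.exists_list_of_mem_corootLattice hsub
  have h0 := h.rs.minuscule_list_sum_eq_zero l.length l hl rfl (fun α hα => by
    rw [hsum]
    obtain ⟨n, hn⟩ := h.rs.exists_int_inner_of_mem hsub hα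
    have h1 := abs_lt.1 (hx α hα)
    have h2 := abs_lt.1 (hx _ (h.rs.map_mem (inv_mem hg) hα))
    rw [inner_inv_apply] at h2
    have h3 := hn
    rw [inner_sub_right] at h3
    rw [hn]
    have h4 : (n : ℝ) < 2 := by linarith
    have h5 : (-2 : ℝ) < n := by linarith
    have h6 : n < 2 := by exact_mod_cast h4
    have h7 : -2 < n := by exact_mod_cast h5
    have h8 : |n| ≤ 1 := abs_le.2 ⟨by omega, by omega⟩
    exact_mod_cast h8)
  rw [hsum, sub_eq_zero] at h0
  have := h.mem_reflGroup_of_fixed hg h0.symm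
  have hempty : {γ | γ ∈ Φ ∧ ⟪γ, x⟫ = 0} = (∅ : Set E) := by
    ext γ
    simp only [Set.mem_ofPred_eq, Set.mem_empty_iff_false, iff_false, not_and]
    exact hx0 γ
  rw [hempty, reflGroup, Set.image_empty, Subgroup.closure_empty] at this
  exact Subgroup.mem_bot.1 this

end HighestRoot

end Folding

namespace Folding

section Average

variable {E : Type*} [NormedAddCommGroup E] [InnerProductSpace ℝ E]

/-- The averaging operator of `ω` as a linear map. -/
noncomputable def avgL (ω : E ≃ₗᵢ[ℝ] E) : E →ₗ[ℝ] E :=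
  (orderOf ω : ℝ)⁻¹ •
    ∑ t ∈ Finset.range (orderOf ω), ((ω ^ (t + 1)).toLinearEquiv : E →ₗ[ℝ] E)

theorem avgL_apply (ω : E ≃ₗᵢ[ℝ] E) (x : E) : avgL ω x = avg ω x := by
  simp [avgL, avg]

theorem pow_succ_apply (ω : E ≃ₗᵢ[ℝ] E) (n : ℕ) (x : E) : (ω ^ (n + 1)) x = ω ((ω ^ n) x) := by
  rw [pow_succ']; rfl

theorem avgL_map (ω : E ≃ₗᵢ[ℝ] E) (x : E) : avgL ω (ω x) = avgL ω x := by
  rw [avgL_apply, avgL_apply, avg, avg]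
  congr 1
  have h1 : ∀ t, (ω ^ (t + 1)) (ω x) = (ω ^ (t + 1 + 1)) x := fun t => by
    rw [pow_succ ω (t + 1)]; rfl
  simp only [h1]
  have h2 := Finset.sum_range_succ (fun t => (ω ^ (t + 1)) x) (orderOf ω)
  rw [Finset.sum_range_succ', pow_succ ω (orderOf ω), pow_orderOf_eq_one, zero_add, pow_one,
    one_mul] at h2
  exact add_right_cancel h2

theorem map_avgL (ω : E ≃ₗᵢ[ℝ] E) (x : E) : ω (avgL ω x) = avgL ω x := by
  conv_rhs => rw [← avgL_map]
  rw [avgL_apply, avgL_apply, avg, avg, map_smul, map_sum]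
  congr 1
  refine Finset.sum_congr rfl fun t _ => ?_
  rw [← pow_succ_apply, pow_succ ω (t + 1)]
  rfl

theorem avgL_pow_map (ω : E ≃ₗᵢ[ℝ] E) (n : ℕ) (x : E) : avgL ω ((ω ^ n) x) = avgL ω x := by
  induction n with
  | zero => simp
  | succ n ih => rw [pow_succ_apply, avgL_map, ih]

theorem pow_apply_of_fixed {ω : E ≃ₗᵢ[ℝ] E} {x : E} (hx : ω x = x) (n : ℕ) : (ω ^ n) x = x := by
  induction n with
  | zero => simp
  | succ n ih => rw [pow_succ_apply, ih, hx]

theorem avgL_of_fixed {ω : E ≃ₗᵢ[ℝ] E} (hω : 0 < orderOf ω) {x : E} (hx : ω x = x) :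
    avgL ω x = x := by
  have : (orderOf ω : ℝ) ≠ 0 := by exact_mod_cast hω.ne'
  rw [avgL_apply, avg, Finset.sum_congr rfl fun t _ => pow_apply_of_fixed hx (t + 1),
    Finset.sum_const, Finset.card_range, ← Nat.cast_smul_eq_nsmul ℝ, smul_smul,
    inv_mul_cancel₀ this, one_smul]

theorem inner_avgL_of_fixed {ω : E ≃ₗᵢ[ℝ] E} (hω : 0 < orderOf ω) (x : E) {y : E}
    (hy : ω y = y) : ⟪avgL ω x, y⟫ = ⟪x, y⟫ := by
  have h0 : (orderOf ω : ℝ) ≠ 0 := by exact_mod_cast hω.ne'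
  have key : ∀ t ∈ Finset.range (orderOf ω), ⟪(ω ^ (t + 1)) x, y⟫ = ⟪x, y⟫ := fun t _ => by
    conv_lhs => rw [← pow_apply_of_fixed hy (t + 1)]
    exact (ω ^ (t + 1)).inner_map_map x y
  rw [avgL_apply, avg, real_inner_smul_left, sum_inner, Finset.sum_congr rfl key,
    Finset.sum_const, Finset.card_range, nsmul_eq_mul, inv_mul_cancel_left₀ h0]

theorem sum_pow_eq_smul_avgL {ω : E ≃ₗᵢ[ℝ] E} (hω : 0 < orderOf ω) (x : E) :
    ∑ t ∈ Finset.range (orderOf ω), (ω ^ (t + 1)) x = (orderOf ω : ℝ) • avgL ω x := by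
  have h0 : (orderOf ω : ℝ) ≠ 0 := by exact_mod_cast hω.ne'
  rw [avgL_apply, avg, smul_smul, mul_inv_cancel₀ h0, one_smul]

/-- The roots whose average vanishes. -/
def kerRoots (Φ : Set E) (ω : E ≃ₗᵢ[ℝ] E) : Set E := {γ | γ ∈ Φ ∧ avgL ω γ = 0}

end Average

section Folding

variable {E : Type*} [NormedAddCommGroup E] [InnerProductSpace ℝ E] [FiniteDimensional ℝ E]
  {Φ : Set E} {Δ : Finset E} {θ : E} {ω : E ≃ₗᵢ[ℝ] E}

/-- A Weyl group element stabilizing the extended base `Δ ∪ {-θ}`. -/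
structure IsFolding (Φ : Set E) (Δ : Finset E) (θ : E) (ω : E ≃ₗᵢ[ℝ] E) : Prop
    extends HasHighest Φ Δ θ where
  mem_reflGroup : ω ∈ reflGroup Φ
  map_simple : ∀ α ∈ Δ, ω α ∈ Δ ∨ ω α = -θ
  map_neg_highest : ω (-θ) ∈ Δ ∨ ω (-θ) = -θ

namespace IsFolding

variable (h : IsFolding Φ Δ θ ω) {α β γ : E}

/-- The Coxeter number, as a real number. -/
noncomputable def cox (h : IsFolding Φ Δ θ ω) : ℝ := 1 + h.base.ht θ

/-- The difference of the heights of a vector and of its average. -/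
noncomputable def defect (h : IsFolding Φ Δ θ ω) : E →ₗ[ℝ] ℝ :=
  h.base.ht - h.base.ht ∘ₗ avgL ω

include h

theorem orderOf_pos : 0 < orderOf ω := h.rs.orderOf_pos_of_mem h.mem_reflGroup

theorem defect_apply (x : E) : h.defect x = h.base.ht x - h.base.ht (avgL ω x) := rfl

theorem one_lt_cox : 1 < h.cox := by
  have := h.ht_pos
  rw [cox]; linarith

theorem abs_ht_lt (hβ : β ∈ Φ) : |h.base.ht β| < h.cox := by
  have h1 := h.ht_le hβ
  have h2 := h.ht_le (h.rs.neg_mem hβ)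
  rw [map_neg] at h2
  rw [abs_lt, cox]
  constructor <;> linarith

theorem map_mem (hβ : β ∈ Φ) : ω β ∈ Φ := h.rs.map_mem h.mem_reflGroup hβ

theorem pow_map_mem (hβ : β ∈ Φ) (n : ℕ) : (ω ^ n) β ∈ Φ :=
  h.rs.map_mem (pow_mem h.mem_reflGroup n) hβ

theorem map_mem_kerRoots (hγ : γ ∈ kerRoots Φ ω) : ω γ ∈ kerRoots Φ ω :=
  ⟨h.map_mem hγ.1, by rw [avgL_map, hγ.2]⟩

theorem ht_map_sub_mem (hβ : β ∈ Φ) :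
    h.base.ht (ω β) - h.base.ht β ∈ AddSubgroup.zmultiples h.cox := by
  have e : h.base.ht (ω β) - h.base.ht β =
      ∑ α ∈ Δ, h.base.coord α β * (h.base.ht (ω α) - h.base.ht α) := by
    conv_lhs => rw [← h.base.sum_coord β]
    simp only [map_sum, map_smul, smul_eq_mul, mul_sub, Finset.sum_sub_distrib]
  rw [e]
  refine sum_mem fun α hα => ?_
  obtain ⟨n, hn⟩ := h.base.exists_coord_eq_intCast hβ hα
  rw [hn, ← zsmul_eq_mul]
  refine zsmul_mem ?_ n
  rcases h.map_simple α hα with h' | h'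
  · rw [h.base.ht_simple hα, h.base.ht_simple h', sub_self]
    exact zero_mem _
  · rw [h.base.ht_simple hα, h', map_neg]
    have : -h.base.ht θ - 1 = -h.cox := by rw [cox]; ring
    rw [this]
    exact neg_mem (AddSubgroup.mem_zmultiples _)

theorem ht_pow_map_sub_mem (hβ : β ∈ Φ) (n : ℕ) :
    h.base.ht ((ω ^ n) β) - h.base.ht β ∈ AddSubgroup.zmultiples h.cox := by
  induction n with
  | zero => simp
  | succ n ih =>
    have := add_mem (h.ht_map_sub_mem (h.pow_map_mem hβ n)) ih
    rw [pow_succ_apply]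
    simpa using this

theorem defect_pow_map_sub_mem (hβ : β ∈ Φ) (n : ℕ) :
    h.defect ((ω ^ n) β) - h.defect β ∈ AddSubgroup.zmultiples h.cox := by
  have := h.ht_pow_map_sub_mem hβ n
  rw [defect_apply, defect_apply, avgL_pow_map]
  simpa using this

theorem nsmul_defect_mem (hβ : β ∈ Φ) {N : ℕ} (hfix : (ω ^ N) β = β) :
    (N : ℝ) * h.defect β ∈ AddSubgroup.zmultiples h.cox := by
  set S := ∑ i ∈ Finset.range N, (ω ^ i) β with hS
  have hfixS : ω S = S := by
    rw [hS, map_sum]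
    simp only [← pow_succ_apply]
    have h2 := Finset.sum_range_succ (fun t => (ω ^ t) β) N
    rw [Finset.sum_range_succ', pow_zero, LinearIsometryEquiv.coe_one, id, hfix] at h2
    exact add_right_cancel h2
  have h0 : h.defect S = 0 := by
    rw [defect_apply, avgL_of_fixed h.orderOf_pos hfixS, sub_self]
  have h1 : ∑ i ∈ Finset.range N, (h.defect ((ω ^ i) β) - h.defect β) ∈
      AddSubgroup.zmultiples h.cox :=
    sum_mem fun i _ => h.defect_pow_map_sub_mem hβ i
  rw [Finset.sum_sub_distrib, ← map_sum, ← hS, h0, Finset.sum_const, Finset.card_range,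
    nsmul_eq_mul, zero_sub] at h1
  simpa using neg_mem h1

/-- If the average of `γ` vanishes, its orbit contains roots of positive inner product with any
vector not orthogonal to `γ`. -/
theorem exists_pow_inner_pos (hγ : γ ∈ kerRoots Φ ω) {x : E} (hx : ⟪x, γ⟫ ≠ 0) :
    ∃ n : ℕ, 0 < ⟪x, (ω ^ n) γ⟫ := by
  by_contra! hcon
  have hsum := sum_pow_eq_smul_avgL h.orderOf_pos γ
  rw [hγ.2, smul_zero] at hsum
  have h1 := congrArg (fun z => ⟪x, z⟫) hsum
  simp only [inner_sum, inner_zero_right] at h1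
  have h2 := (Finset.sum_eq_zero_iff_of_nonpos fun t _ => hcon (t + 1)).1 h1
    (orderOf ω - 1) (Finset.mem_range.2 (Nat.sub_lt h.orderOf_pos one_pos))
  have h3 : orderOf ω - 1 + 1 = orderOf ω := Nat.sub_add_cancel h.orderOf_pos
  rw [h3, pow_orderOf_eq_one] at h2
  exact hx h2

/-- A Weyl group element is a product of reflections in roots with vanishing average. -/
theorem mem_reflGroup_kerRoots : ω ∈ reflGroup (kerRoots Φ ω) := by
  have := h.rs.finite.to_subtype
  let f : {β : Φ // avgL ω β.1 ≠ 0} → Module.Dual ℝ E := fun β => innerₗ E β.1.1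
  obtain ⟨y, hy, hyf⟩ := Module.Dual.exists_forall_mem_ne_zero_of_forall_exists
    (fixedSubmodule ω) f (fun β => ⟨avgL ω β.1.1, by
      simp [fixedSubmodule, map_avgL], by
      have : ⟪avgL ω β.1.1, avgL ω β.1.1⟫ ≠ 0 := inner_self_ne_zero.2 β.2
      rwa [inner_avgL_of_fixed h.orderOf_pos _ (map_avgL ω _)] at this⟩)
  have hfix : ω y = y := by
    simpa [fixedSubmodule, sub_eq_zero] using hy
  refine reflGroup_mono ?_ (h.mem_reflGroup_of_fixed h.mem_reflGroup hfix)
  rintro γ ⟨hγ, h0⟩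
  refine ⟨hγ, ?_⟩
  by_contra hne
  exact hyf ⟨⟨γ, hγ⟩, hne⟩ h0

theorem prod_filter_apply {Z : Set E} [DecidablePred (· ∈ Z)] {P : Set E}
    (hZ : ∀ γ ∈ Z, ∀ δ ∈ P, δ ∉ Z → ⟪γ, δ⟫ = 0) {l : List E} (hl : ∀ a ∈ l, a ∈ P) {x : E}
    (hx : ∀ δ ∈ P, δ ∉ Z → ⟪x, δ⟫ = 0) :
    (l.map refl).prod x = ((l.filter (· ∈ Z)).map refl).prod x ∧
      ∀ δ ∈ P, δ ∉ Z → ⟪(l.map refl).prod x, δ⟫ = 0 := by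
  induction l with
  | nil => simpa using hx
  | cons a l ih =>
    obtain ⟨h1, h2⟩ := ih fun b hb => hl b (by simp [hb])
    simp only [List.map_cons, List.prod_cons, LinearIsometryEquiv.coe_mul, Function.comp_apply]
    by_cases ha : a ∈ Z
    · simp only [ha, decide_true, List.filter_cons_of_pos, List.map_cons, List.prod_cons,
        LinearIsometryEquiv.coe_mul, Function.comp_apply, ← h1, true_and]
      intro δ hδ hδZ
      rw [refl_apply, inner_sub_left, h2 δ hδ hδZ, real_inner_smul_left, hZ a ha δ hδ hδZ,
        mul_zero, sub_zero]
    · have : refl a ((l.map refl).prod x) = (l.map refl).prod x :=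
        refl_of_inner_eq_zero (by rw [real_inner_comm]; exact h2 a (hl a (by simp)) ha)
      rw [this]
      refine ⟨?_, h2⟩
      rw [List.filter_cons_of_neg (by simpa using ha), h1]

theorem sub_map_mem_corootLattice {Z : Set E} (hZ : Z ⊆ Φ) {x : E}
    (hx : ∀ γ ∈ Z, ∃ n : ℤ, ⟪γ, x⟫ = n) {g : E ≃ₗᵢ[ℝ] E} (hg : g ∈ reflGroup Z) :
    x - g x ∈ corootLattice Z := by
  obtain ⟨l, hl, rfl⟩ := exists_list_of_mem_reflGroup hg
  clear hg
  induction l with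
  | nil => simp
  | cons a l ih =>
    have h1 := ih fun b hb => hl b (by simp [hb])
    have ha : a ∈ Z := hl a (by simp)
    simp only [List.map_cons, List.prod_cons, LinearIsometryEquiv.coe_mul, Function.comp_apply]
    set y := (l.map refl).prod x
    obtain ⟨m, hm⟩ := hx a ha
    obtain ⟨k, hk⟩ := h.rs.exists_int_inner_of_mem
      (AddSubgroup.closure_mono (Set.image_mono hZ) h1) (hZ ha)
    have e : x - refl a y = (x - y) + (m - k) • coroot a := by
      have : ⟪a, y⟫ = ((m - k : ℤ) : ℝ) := by
        rw [inner_sub_right, hm] at hk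
        push_cast
        linarith
      rw [refl_apply, inner_coroot, this, ← Int.cast_smul_eq_zsmul ℝ, coroot, smul_smul,
        mul_comm]
      abel
    rw [e]
    have hc : coroot a ∈ corootLattice Z := AddSubgroup.subset_closure ⟨a, ha, rfl⟩
    exact add_mem h1 (zsmul_mem hc _)

theorem exists_int_of_mem_zmultiples {x : ℝ} (hx : x ∈ AddSubgroup.zmultiples h.cox) :
    ∃ n : ℤ, h.cox⁻¹ * x = n := by
  obtain ⟨n, rfl⟩ := AddSubgroup.mem_zmultiples_iff.1 hx
  have := h.one_lt_cox
  refine ⟨n, ?_⟩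
  rw [zsmul_eq_mul]
  field_simp

/-- A root orthogonal to the roots with vanishing average outside of `Z` is fixed by `ω ^ N`
when `N` annihilates the heights of the elements of `Z` modulo the Coxeter number. -/
theorem pow_apply_eq_self {Z : Set E} (hZP : Z ⊆ kerRoots Φ ω)
    (hZ : ∀ γ ∈ Z, ∀ δ ∈ kerRoots Φ ω, δ ∉ Z → ⟪γ, δ⟫ = 0)
    (hβ : ∀ δ ∈ kerRoots Φ ω, δ ∉ Z → ⟪β, δ⟫ = 0) {N : ℕ}
    (hN : ∀ γ ∈ Z, (N : ℝ) * h.base.ht γ ∈ AddSubgroup.zmultiples h.cox) :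
    (ω ^ N) β = β := by
  classical
  have hZΦ : Z ⊆ Φ := fun γ hγ => (hZP hγ).1
  obtain ⟨l, hl, hprod⟩ := exists_list_of_mem_reflGroup h.mem_reflGroup_kerRoots
  set w := ((l.filter (· ∈ Z)).map refl).prod with hw
  have hwZ : w ∈ reflGroup Z := list_prod_mem_reflGroup fun a ha => by
    simpa using (List.mem_filter.1 ha).2
  have hωw : ∀ x, (∀ δ ∈ kerRoots Φ ω, δ ∉ Z → ⟪x, δ⟫ = 0) →
      ω x = w x ∧ ∀ δ ∈ kerRoots Φ ω, δ ∉ Z → ⟪ω x, δ⟫ = 0 := by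
    intro x hx
    have := h.prod_filter_apply hZ hl hx
    rwa [hprod] at this
  have hpow : ∀ n : ℕ, (ω ^ n) β = (w ^ n) β ∧
      ∀ δ ∈ kerRoots Φ ω, δ ∉ Z → ⟪(ω ^ n) β, δ⟫ = 0 := by
    intro n
    induction n with
    | zero => simpa using hβ
    | succ n ih =>
      have h1 := hωw _ ih.2
      rw [pow_succ_apply, pow_succ_apply, ← ih.1]
      exact h1
  have hwmap : ∀ γ ∈ Z, w γ ∈ Z := by
    intro γ hγ
    obtain ⟨h1, h2⟩ := hωw γ (hZ γ hγ)
    have h3 := h.map_mem_kerRoots (hZP hγ)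
    rw [← h1]
    by_contra hnot
    exact (h.rs.inner_self_pos h3.1).ne' (h2 _ h3 hnot)
  have hwΦ : w ∈ reflGroup Φ := reflGroup_mono hZΦ hwZ
  have hwinv : ∀ γ ∈ Z, w⁻¹ γ ∈ Z := by
    intro γ hγ
    have h1 : ∀ n : ℕ, (w ^ n) γ ∈ Z := by
      intro n
      induction n with
      | zero => simpa using hγ
      | succ n ih => rw [pow_succ_apply]; exact hwmap _ ih
    have h2 : w⁻¹ = w ^ (orderOf w - 1) := by
      rw [inv_eq_iff_mul_eq_one, ← pow_succ',
        Nat.sub_add_cancel (h.rs.orderOf_pos_of_mem hwΦ), pow_orderOf_eq_one]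
    rw [h2]
    exact h1 _
  set ρ : E := (InnerProductSpace.toDual ℝ E).symm (LinearMap.toContinuousLinearMap h.base.ht)
  have hρ : ∀ x, ⟪x, ρ⟫ = h.base.ht x := fun x => by
    rw [real_inner_comm, InnerProductSpace.toDual_symm_apply]
    rfl
  set x₀ : E := h.cox⁻¹ • ρ with hx₀
  have hcox := h.one_lt_cox
  have hcox0 : 0 < h.cox⁻¹ := by positivity
  have hx₀i : ∀ x, ⟪x, x₀⟫ = h.cox⁻¹ * h.base.ht x := fun x => by
    rw [hx₀, real_inner_smul_right, hρ]
  set v := x₀ - w x₀ with hv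
  have hvP : ∀ γ ∈ Z, ∃ n : ℤ, ⟪γ, v⟫ = n := by
    intro γ hγ
    have h1 := hwinv γ hγ
    have h2 : ω (w⁻¹ γ) = γ := by
      rw [(hωw _ (hZ _ h1)).1]
      exact w.apply_symm_apply γ
    have h3 := h.ht_map_sub_mem (hZΦ h1)
    rw [h2] at h3
    have h4 := h.exists_int_of_mem_zmultiples h3
    rwa [hv, inner_sub_right, ← inner_inv_apply, hx₀i, hx₀i, ← mul_sub]
  have hNv : N • v ∈ corootLattice Z := by
    have h1 := h.sub_map_mem_corootLattice hZΦ (x := N • x₀) (fun γ hγ => by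
      obtain ⟨n, hn⟩ := h.exists_int_of_mem_zmultiples (hN γ hγ)
      refine ⟨n, ?_⟩
      rw [← Nat.cast_smul_eq_nsmul ℝ, real_inner_smul_right, hx₀i, ← hn]
      ring) hwZ
    rwa [map_nsmul, ← smul_sub] at h1
  have htel : ∀ n : ℕ, x₀ - (w ^ n) x₀ - n • v ∈ corootLattice Z := by
    intro n
    induction n with
    | zero => simp
    | succ n ih =>
      have h1 := h.sub_map_mem_corootLattice hZΦ hvP (pow_mem hwZ n)
      have h2 : (w ^ n) v = (w ^ n) x₀ - (w ^ (n + 1)) x₀ := by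
        rw [hv, map_sub, pow_succ]
        rfl
      have h3 := sub_mem ih h1
      rw [h2] at h3
      convert h3 using 1
      rw [succ_nsmul]
      abel
  have hmem : x₀ - (w ^ N) x₀ ∈ corootLattice Φ := by
    have := add_mem (htel N) hNv
    rw [sub_add_cancel] at this
    exact AddSubgroup.closure_mono (Set.image_mono hZΦ) this
  have h1 := h.eq_one_of_sub_mem (x := x₀) (fun α hα => by
    have := h.abs_ht_lt hα
    rw [hx₀i, abs_mul, abs_of_pos hcox0, inv_mul_lt_iff₀ (by linarith), mul_one]
    exact this) (fun α hα => by
    rw [hx₀i]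
    exact mul_ne_zero hcox0.ne' (h.ht_ne_zero hα)) (pow_mem hwΦ N) hmem
  rw [(hpow N).1, h1]
  rfl

end IsFolding

end Folding

end Folding

namespace Folding

section Components

variable {E : Type*} [NormedAddCommGroup E] [InnerProductSpace ℝ E]
  {Φ : Set E} {Δ : Finset E} {θ : E} {ω : E ≃ₗᵢ[ℝ] E}

/-- Two vectors are linked in `P` if they are joined by a chain of elements of `P` with
successive elements not orthogonal. -/
def Linked (P : Set E) : E → E → Prop :=
  Relation.ReflTransGen fun a b => a ∈ P ∧ b ∈ P ∧ ⟪a, b⟫ ≠ 0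

theorem Linked.symm {P : Set E} {a b : E} (hab : Linked P a b) : Linked P b a := by
  have : Std.Symm fun a b : E => a ∈ P ∧ b ∈ P ∧ ⟪a, b⟫ ≠ 0 :=
    ⟨fun a b h => ⟨h.2.1, h.1, by rw [real_inner_comm]; exact h.2.2⟩⟩
  exact Std.Symm.symm (r := Relation.ReflTransGen _) _ _ hab

theorem linked_of_inner_ne_zero {P : Set E} {a b : E} (ha : a ∈ P) (hb : b ∈ P)
    (hab : ⟪a, b⟫ ≠ 0) : Linked P a b := Relation.ReflTransGen.single ⟨ha, hb, hab⟩

/-- The elements of `P` linked to an element not orthogonal to `x`. -/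
def touched (P : Set E) (x : E) : Set E :=
  {γ | γ ∈ P ∧ ∃ γ' ∈ P, Linked P γ γ' ∧ ⟪x, γ'⟫ ≠ 0}

theorem inner_eq_zero_of_notMem_touched {P : Set E} {x δ : E} (hδ : δ ∈ P)
    (hδx : δ ∉ touched P x) : ⟪x, δ⟫ = 0 := by
  by_contra hne
  exact hδx ⟨hδ, δ, hδ, Relation.ReflTransGen.refl, hne⟩

theorem inner_eq_zero_of_mem_touched {P : Set E} {x γ δ : E} (hγ : γ ∈ touched P x)
    (hδ : δ ∈ P) (hδx : δ ∉ touched P x) : ⟪γ, δ⟫ = 0 := by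
  by_contra hne
  obtain ⟨hγP, γ', hγ', hlink, hin⟩ := hγ
  exact hδx ⟨hδ, γ', hγ', (linked_of_inner_ne_zero hγP hδ hne).symm.trans hlink, hin⟩

theorem touched_sub_subset {P : Set E} {x δ : E} (hδ : δ ∈ P) (hxδ : ⟪x, δ⟫ ≠ 0) :
    touched P (x - δ) ⊆ touched P x := by
  rintro γ ⟨hγ, γ', hγ', hlink, hin⟩
  by_cases h0 : ⟪x, γ'⟫ = 0
  · rw [inner_sub_left, h0, zero_sub, neg_ne_zero] at hin
    exact ⟨hγ, δ, hδ, hlink.trans (linked_of_inner_ne_zero hδ hγ' hin).symm, hxδ⟩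
  · exact ⟨hγ, γ', hγ', hlink, h0⟩

theorem inner_eq_zero_of_mem_closure {S : Set E} {x y : E} (hx : x ∈ AddSubmonoid.closure S)
    (hS : ∀ s ∈ S, ⟪s, y⟫ = 0) : ⟪x, y⟫ = 0 := by
  induction hx using AddSubmonoid.closure_induction with
  | mem s hs => exact hS s hs
  | zero => simp
  | add a b _ _ ha hb => rw [inner_add_left, ha, hb, add_zero]

variable [FiniteDimensional ℝ E]

namespace IsFolding

variable (h : IsFolding Φ Δ θ ω) {α β γ δ : E}

/-- The Coxeter number. -/
noncomputable def coxZ (h : IsFolding Φ Δ θ ω) : ℤ := 1 + ⌊h.base.ht θ⌋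

/-- The height of a root modulo the Coxeter number. -/
noncomputable def res (h : IsFolding Φ Δ θ ω) (γ : E) : ℤ := ⌊h.base.ht γ⌋ % h.coxZ

include h

theorem floor_ht (hβ : β ∈ Φ) : (⌊h.base.ht β⌋ : ℝ) = h.base.ht β := by
  obtain ⟨n, hn⟩ := h.base.exists_ht_eq_intCast hβ
  rw [hn, Int.floor_intCast]

theorem coxZ_cast : (h.coxZ : ℝ) = h.cox := by
  rw [coxZ, cox, ← h.floor_ht h.mem]
  push_cast
  simp

theorem coxZ_pos : 0 < h.coxZ := by
  have h1 := h.one_lt_cox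
  rw [← h.coxZ_cast] at h1
  have : 1 < h.coxZ := by exact_mod_cast h1
  omega

theorem res_eq_res_iff (hβ : β ∈ Φ) (hγ : γ ∈ Φ) : h.res β = h.res γ ↔
    h.base.ht β - h.base.ht γ ∈ AddSubgroup.zmultiples h.cox := by
  have e : h.base.ht β - h.base.ht γ = ((⌊h.base.ht β⌋ - ⌊h.base.ht γ⌋ : ℤ) : ℝ) := by
    push_cast
    rw [h.floor_ht hβ, h.floor_ht hγ]
  rw [res, res, Int.emod_eq_emod_iff_emod_sub_eq_zero, ← Int.dvd_iff_emod_eq_zero,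
    AddSubgroup.mem_zmultiples_iff, e, ← h.coxZ_cast]
  constructor
  · rintro ⟨k, hk⟩
    refine ⟨k, ?_⟩
    rw [zsmul_eq_mul, mul_comm]
    exact_mod_cast hk.symm
  · rintro ⟨k, hk⟩
    refine ⟨k, ?_⟩
    rw [zsmul_eq_mul, mul_comm] at hk
    exact_mod_cast hk.symm

theorem res_pow_map (hβ : β ∈ Φ) (n : ℕ) : h.res ((ω ^ n) β) = h.res β :=
  (h.res_eq_res_iff (h.pow_map_mem hβ n) hβ).2 (h.ht_pow_map_sub_mem hβ n)

theorem res_pos (hβ : β ∈ Φ) : 0 < h.res β := by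
  refine lt_of_le_of_ne (Int.emod_nonneg _ h.coxZ_pos.ne') fun h0 => ?_
  have hdvd : h.coxZ ∣ ⌊h.base.ht β⌋ := Int.dvd_of_emod_eq_zero h0.symm
  have habs := h.abs_ht_lt hβ
  rw [← h.floor_ht hβ, ← h.coxZ_cast] at habs
  have habs' : |⌊h.base.ht β⌋| < h.coxZ := by exact_mod_cast habs
  have := Int.eq_zero_of_abs_lt_dvd hdvd habs'
  refine h.ht_ne_zero hβ ?_
  rw [← h.floor_ht hβ, this, Int.cast_zero]

theorem res_lt (γ : E) : h.res γ < h.coxZ := Int.emod_lt_of_pos _ h.coxZ_pos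

theorem res_sub (hγ : γ ∈ Φ) (hδ : δ ∈ Φ) (hsub : γ - δ ∈ Φ) (hle : h.res δ ≤ h.res γ) :
    h.res (γ - δ) = h.res γ - h.res δ := by
  have e : ⌊h.base.ht (γ - δ)⌋ = ⌊h.base.ht γ⌋ - ⌊h.base.ht δ⌋ := by
    have : (⌊h.base.ht (γ - δ)⌋ : ℝ) = (⌊h.base.ht γ⌋ : ℝ) - (⌊h.base.ht δ⌋ : ℝ) := by
      rw [h.floor_ht hγ, h.floor_ht hδ, h.floor_ht hsub, map_sub]
    exact_mod_cast this
  have h1 := h.res_pos hδ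
  have h2 := h.res_lt γ
  rw [res, e, Int.sub_emod]
  exact Int.emod_eq_of_lt (sub_nonneg.2 hle) (by change h.res γ - h.res δ < _; omega)

theorem sub_mem_kerRoots (hγ : γ ∈ kerRoots Φ ω) (hδ : δ ∈ kerRoots Φ ω) (hne : γ ≠ δ)
    (hpos : 0 < ⟪γ, δ⟫) : γ - δ ∈ kerRoots Φ ω :=
  ⟨h.rs.sub_mem hγ.1 hδ.1 hne hpos, by rw [map_sub, hγ.2, hδ.2, sub_zero]⟩

/-- In each component of the roots with vanishing average there is a residue class of heights
whose roots generate the component by addition. -/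
theorem exists_generating_class (hγ : γ ∈ kerRoots Φ ω) : ∃ (Γ : Set E) (k : ℤ),
    Γ ⊆ kerRoots Φ ω ∧ (∀ δ ∈ Γ, h.res δ = k) ∧
      ∀ δ ∈ kerRoots Φ ω, Linked (kerRoots Φ ω) γ δ → δ ∈ AddSubmonoid.closure Γ := by
  set P := kerRoots Φ ω with hP
  set C : Set E := {δ | δ ∈ P ∧ Linked P γ δ} with hC
  have hCfin : C.Finite := h.rs.finite.subset fun δ hδ => hδ.1.1
  obtain ⟨δ₀, hδ₀, hmin⟩ := Set.exists_min_image C h.res hCfin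
    ⟨γ, hγ, Relation.ReflTransGen.refl⟩
  have hCstep : ∀ a ∈ C, ∀ b ∈ P, ⟪a, b⟫ ≠ 0 → b ∈ C := fun a ha b hb hab =>
    ⟨hb, ha.2.trans (linked_of_inner_ne_zero ha.1 hb hab)⟩
  set Γ : Set E := {δ | δ ∈ C ∧ h.res δ = h.res δ₀} with hΓ
  have key : ∀ n : ℕ, ∀ a ∈ C, h.res a < n → (∃ b ∈ Γ, ⟪a, b⟫ ≠ 0) →
      a ∈ AddSubmonoid.closure Γ := by
    intro n
    induction n with
    | zero => intro a ha hlt; exact absurd (h.res_pos ha.1.1) (by simpa using hlt.le)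
    | succ n ih =>
      intro a ha hlt ⟨b, hb, hab⟩
      obtain ⟨i, hi⟩ := h.exists_pow_inner_pos hb.1.1 hab
      set d := (ω ^ i) b with hd
      have hdP : d ∈ P := ⟨h.pow_map_mem hb.1.1.1 i, by rw [hd, avgL_pow_map, hb.1.1.2]⟩
      have hdC : d ∈ C := hCstep a ha d hdP hi.ne'
      have hdres : h.res d = h.res δ₀ := by rw [hd, h.res_pow_map hb.1.1.1, hb.2]
      have hdΓ : d ∈ Γ := ⟨hdC, hdres⟩
      have hdd := h.rs.inner_self_pos hdP.1
      by_cases hne : a = d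
      · rw [hne]; exact AddSubmonoid.subset_closure hdΓ
      have heP : a - d ∈ P := h.sub_mem_kerRoots ha.1 hdP hne hi
      have hee := h.rs.inner_self_pos heP.1
      have heC : a - d ∈ C := by
        by_cases h0 : ⟪a, a - d⟫ = 0
        · refine hCstep d hdC _ heP fun h1 => ?_
          rw [inner_sub_left, h0, h1, sub_zero] at hee
          exact lt_irrefl _ hee
        · exact hCstep a ha _ heP h0
      have hδ₀pos := h.res_pos hδ₀.1.1
      have heres : h.res (a - d) = h.res a - h.res δ₀ := by
        rw [← hdres]
        exact h.res_sub ha.1.1 hdP.1 heP.1 (by rw [hdres]; exact hmin a ha)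
      have hsum : (a - d) + d = a := sub_add_cancel a d
      by_cases hE : ∃ c ∈ Γ, ⟪a - d, c⟫ ≠ 0
      · rw [← hsum]
        exact add_mem (ih _ heC (by push_cast at hlt; omega) hE)
          (AddSubmonoid.subset_closure hdΓ)
      · push Not at hE
        exfalso
        have h0 := hE d hdΓ
        have hmem := h.rs.sub_smul_mem hdP.1 ha.1.1
        have e : ⟪coroot d, a⟫ = 2 := by
          have h1 : ⟪d, a⟫ = ⟪d, d⟫ := by
            rw [real_inner_comm]
            rw [inner_sub_left] at h0
            linarith
          rw [inner_coroot, h1]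
          field_simp
        have e2 : a - ⟪coroot d, a⟫ • d = (a - d) - d := by
          rw [e, two_smul]; abel
        rw [e2] at hmem
        have hfP : (a - d) - d ∈ P :=
          ⟨hmem, by rw [map_sub, map_sub, ha.1.2, hdP.2, sub_zero, sub_zero]⟩
        have hfd : ⟪(a - d) - d, d⟫ ≠ 0 := by
          rw [inner_sub_left, h0, zero_sub, neg_ne_zero]
          exact hdd.ne'
        have hfC : (a - d) - d ∈ C :=
          hCstep d hdC _ hfP (by rwa [real_inner_comm])
        have hfres : h.res ((a - d) - d) = h.res (a - d) - h.res δ₀ := by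
          rw [← hdres]
          exact h.res_sub heP.1 hdP.1 hmem (by rw [hdres]; exact hmin _ heC)
        have h1 := ih _ hfC (by push_cast at hlt; omega) ⟨d, hdΓ, hfd⟩
        have h2 : a - d ∈ AddSubmonoid.closure Γ := by
          have := add_mem h1 (AddSubmonoid.subset_closure hdΓ)
          rwa [sub_add_cancel] at this
        refine hee.ne' (inner_eq_zero_of_mem_closure h2 fun s hs => ?_)
        rw [real_inner_comm]
        exact hE s hs
  have key' : ∀ a ∈ C, (∃ b ∈ Γ, ⟪a, b⟫ ≠ 0) → a ∈ AddSubmonoid.closure Γ := by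
    intro a ha
    obtain ⟨n, hn⟩ : ∃ n : ℕ, h.res a < n := ⟨(h.res a).toNat + 1, by
      push_cast
      have := Int.self_le_toNat (h.res a)
      omega⟩
    exact key n a ha hn
  have hδ₀Γ : δ₀ ∈ Γ := ⟨hδ₀, rfl⟩
  have hgood : ∀ a, Linked P δ₀ a → a ∈ C ∧ ∃ b ∈ Γ, ⟪a, b⟫ ≠ 0 := by
    intro a ha
    induction ha with
    | refl => exact ⟨hδ₀, δ₀, hδ₀Γ, (h.rs.inner_self_pos hδ₀.1.1).ne'⟩
    | tail _ hbc ih =>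
      refine ⟨hCstep _ ih.1 _ hbc.2.1 hbc.2.2, ?_⟩
      by_contra! hcon
      refine hbc.2.2 (inner_eq_zero_of_mem_closure (key' _ ih.1 ih.2) fun s hs => ?_)
      rw [real_inner_comm]
      exact hcon s hs
  refine ⟨Γ, h.res δ₀, fun δ hδ => hδ.1.1, fun δ hδ => hδ.2, fun δ hδ hlink => ?_⟩
  have := hgood δ (hδ₀.2.symm.trans hlink)
  exact key' δ this.1 this.2

theorem pow_apply_eq_self_of_touched {N : ℕ}
    (hN : ∀ γ ∈ touched (kerRoots Φ ω) β,
      (N : ℝ) * h.base.ht γ ∈ AddSubgroup.zmultiples h.cox) : (ω ^ N) β = β :=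
  h.pow_apply_eq_self (fun _ hγ => hγ.1)
    (fun _ hγ _ hδ hδZ => inner_eq_zero_of_mem_touched hγ hδ hδZ)
    (fun _ hδ hδZ => inner_eq_zero_of_notMem_touched hδ hδZ) hN

/-- Every nonzero average of a root is the average of a root with defect divisible by the
Coxeter number. -/
theorem exists_defect_mem (hβ : β ∈ Φ) (hβ0 : avgL ω β ≠ 0) :
    ∃ β' ∈ Φ, avgL ω β' = avgL ω β ∧ h.defect β' ∈ AddSubgroup.zmultiples h.cox := by
  set P := kerRoots Φ ω with hP
  have hPfin : P.Finite := h.rs.finite.subset fun δ hδ => hδ.1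
  set S : Set E := {b | b ∈ Φ ∧ avgL ω b = avgL ω β} with hS
  obtain ⟨b₀, hb₀, hmin⟩ := Set.exists_min_image S (fun b => (touched P b).ncard)
    (h.rs.finite.subset fun b hb => hb.1) ⟨β, hβ, rfl⟩
  set Y := touched P b₀ with hY
  have hYfin : Y.Finite := hPfin.subset fun γ hγ => hγ.1
  have hstep : ∀ b ∈ S, touched P b = Y → ∀ d ∈ P, 0 < ⟪b, d⟫ →
      b - d ∈ S ∧ touched P (b - d) = Y := by
    intro b hb hbY d hd hpos
    have hne : b ≠ d := by
      rintro rfl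
      exact hβ0 (by rw [← hb.2, hd.2])
    have hmem : b - d ∈ S :=
      ⟨h.rs.sub_mem hb.1 hd.1 hne hpos, by rw [map_sub, hb.2, hd.2, sub_zero]⟩
    refine ⟨hmem, Set.eq_of_subset_of_ncard_le ?_ (hmin _ hmem) hYfin⟩
    rw [← hbY]
    exact touched_sub_subset hd hpos.ne'
  let p : ℝ → Prop := fun η => ∀ b ∈ S, touched P b = Y → ∃ b' ∈ S, touched P b' = Y ∧
    h.defect b - η - h.defect b' ∈ AddSubgroup.zmultiples h.cox
  have hp_add : ∀ η₁ η₂, p η₁ → p η₂ → p (η₁ + η₂) := by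
    intro η₁ η₂ h1 h2 b hb hbY
    obtain ⟨b₁, hb₁, hbY₁, hm₁⟩ := h1 b hb hbY
    obtain ⟨b₂, hb₂, hbY₂, hm₂⟩ := h2 b₁ hb₁ hbY₁
    refine ⟨b₂, hb₂, hbY₂, ?_⟩
    have := add_mem hm₁ hm₂
    ring_nf at this ⊢
    exact this
  have hp_lat : ∀ η ∈ AddSubgroup.zmultiples h.cox, p η := by
    intro η hη b hb hbY
    refine ⟨b, hb, hbY, ?_⟩
    have := neg_mem hη
    ring_nf at this ⊢
    exact this
  have hp_zero : p 0 := hp_lat 0 (zero_mem _)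
  have hp_neg : ∀ z : ℤ, p z → p (-z : ℤ) := by
    intro z hz
    have hnat : ∀ n : ℕ, p (n * z) := by
      intro n
      induction n with
      | zero => simpa using hp_zero
      | succ n ih =>
        have := hp_add _ _ ih hz
        push_cast
        rwa [add_mul, one_mul]
    obtain ⟨m, hm⟩ := Int.eq_ofNat_of_zero_le (by have := h.coxZ_pos; omega : 0 ≤ h.coxZ - 1)
    have h1 : p (-(z : ℝ) * h.cox) := hp_lat _ (AddSubgroup.mem_zmultiples_iff.2
      ⟨-z, by rw [zsmul_eq_mul]; push_cast; ring⟩)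
    have h2 := hp_add _ _ (hnat m) h1
    have h3 : ((-z : ℤ) : ℝ) = m * z + -(z : ℝ) * h.cox := by
      have : (m : ℝ) = h.coxZ - 1 := by exact_mod_cast hm.symm
      rw [this, ← h.coxZ_cast]
      push_cast
      ring
    rwa [h3]
  have hp_ht : ∀ γ ∈ Y, p (h.base.ht γ) := by
    intro γ hγ
    obtain ⟨Γ, k, hΓP, hΓk, hΓgen⟩ := h.exists_generating_class hγ.1
    have hclos : ∀ x ∈ AddSubmonoid.closure Γ, p (h.base.ht x) := by
      intro x hx
      induction hx using AddSubmonoid.closure_induction with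
      | mem δ hδ =>
        intro b hb hbY
        obtain ⟨γ', hγ', hlink, hin⟩ := (hbY ▸ hγ : γ ∈ touched P b).2
        obtain ⟨d, hd, hbd⟩ : ∃ d ∈ Γ, ⟪b, d⟫ ≠ 0 := by
          by_contra! hcon
          refine hin ?_
          rw [real_inner_comm]
          refine inner_eq_zero_of_mem_closure (hΓgen γ' hγ' hlink) fun s hs => ?_
          rw [real_inner_comm]
          exact hcon s hs
        obtain ⟨i, hi⟩ := h.exists_pow_inner_pos (hΓP hd) hbd
        have hdP : (ω ^ i) d ∈ P :=
          ⟨h.pow_map_mem (hΓP hd).1 i, by rw [avgL_pow_map, (hΓP hd).2]⟩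
        obtain ⟨h1, h2⟩ := hstep b hb hbY _ hdP hi
        refine ⟨_, h1, h2, ?_⟩
        have hres : h.res ((ω ^ i) d) = h.res δ := by
          rw [h.res_pow_map (hΓP hd).1, hΓk d hd, hΓk δ hδ]
        have h3 := (h.res_eq_res_iff hdP.1 (hΓP hδ).1).1 hres
        have h4 : h.defect ((ω ^ i) d) = h.base.ht ((ω ^ i) d) := by
          rw [h.defect_apply, hdP.2, map_zero, sub_zero]
        rw [map_sub, h4]
        convert h3 using 1
        ring
      | zero => simpa using hp_zero
      | add x y _ _ hx hy => rw [map_add]; exact hp_add _ _ hx hy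
    exact hclos γ (hΓgen γ hγ.1 Relation.ReflTransGen.refl)
  set H : AddSubgroup ℤ :=
    AddSubgroup.closure (insert h.coxZ ((fun γ => ⌊h.base.ht γ⌋) '' Y)) with hH
  have hpH : ∀ z ∈ H, p (z : ℝ) := by
    intro z hz
    induction hz using AddSubgroup.closure_induction with
    | mem x hx =>
      rcases hx with rfl | ⟨γ, hγ, rfl⟩
      · rw [h.coxZ_cast]
        exact hp_lat _ (AddSubgroup.mem_zmultiples _)
      · simp only
        rw [h.floor_ht hγ.1.1]
        exact hp_ht γ hγ
    | zero => simpa using hp_zero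
    | add x y _ _ hx hy => push_cast; exact hp_add _ _ hx hy
    | neg x _ hx => exact hp_neg x hx
  obtain ⟨g, hg⟩ := Int.subgroup_cyclic H
  have hgen : ∀ z ∈ H, ∃ k : ℤ, z = k * g := by
    intro z hz
    rw [hg, ← AddSubgroup.zmultiples_eq_closure] at hz
    obtain ⟨k, hk⟩ := AddSubgroup.mem_zmultiples_iff.1 hz
    exact ⟨k, by rw [← hk, zsmul_eq_mul]; rfl⟩
  have hgH : g ∈ H := by rw [hg]; exact AddSubgroup.subset_closure rfl
  obtain ⟨n, hn⟩ := hgen h.coxZ (AddSubgroup.subset_closure (Set.mem_insert _ _))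
  have hn0 : n ≠ 0 := by
    rintro rfl
    have := h.coxZ_pos
    rw [hn, zero_mul] at this
    exact lt_irrefl _ this
  have hnabs : (n.natAbs : ℝ) = n ∨ (n.natAbs : ℝ) = -n := by
    rw [Nat.cast_natAbs, Int.cast_abs]
    exact abs_choice _
  have hfix : (ω ^ n.natAbs) b₀ = b₀ := by
    refine h.pow_apply_eq_self_of_touched fun γ hγ => ?_
    obtain ⟨k, hk⟩ := hgen ⌊h.base.ht γ⌋
      (AddSubgroup.subset_closure (Set.mem_insert_of_mem _ ⟨γ, hγ, rfl⟩))
    have h1 : (n : ℝ) * h.base.ht γ ∈ AddSubgroup.zmultiples h.cox := by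
      refine AddSubgroup.mem_zmultiples_iff.2 ⟨k, ?_⟩
      rw [← h.floor_ht hγ.1.1, hk, ← h.coxZ_cast, hn, zsmul_eq_mul]
      push_cast
      ring
    rcases hnabs with h2 | h2
    · rwa [h2]
    · rw [h2, neg_mul]; exact neg_mem h1
  have hdef := h.nsmul_defect_mem hb₀.1 hfix
  have hdefn : (n : ℝ) * h.defect b₀ ∈ AddSubgroup.zmultiples h.cox := by
    rcases hnabs with h2 | h2
    · rwa [h2] at hdef
    · rw [h2, neg_mul] at hdef; simpa using neg_mem hdef
  obtain ⟨c, hc⟩ := AddSubgroup.mem_zmultiples_iff.1 hdefn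
  have hdefeq : h.defect b₀ = ((c * g : ℤ) : ℝ) := by
    have hn0' : (n : ℝ) ≠ 0 := by exact_mod_cast hn0
    rw [zsmul_eq_mul, ← h.coxZ_cast, hn] at hc
    apply mul_left_cancel₀ hn0'
    rw [← hc]
    push_cast
    ring
  obtain ⟨b', hb', -, hmem⟩ := hpH (c * g) (by
    rw [← smul_eq_mul]
    exact zsmul_mem hgH c) b₀ hb₀ rfl
  refine ⟨b', hb'.1, hb'.2, ?_⟩
  rw [hdefeq, sub_self, zero_sub] at hmem
  simpa using neg_mem hmem

end IsFolding

end Components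

end Folding

namespace Folding

section SimpleAverages

variable {E : Type*} [NormedAddCommGroup E] [InnerProductSpace ℝ E]

theorem avgL_zpow_map (ω : E ≃ₗᵢ[ℝ] E) (n : ℤ) (x : E) : avgL ω ((ω ^ n) x) = avgL ω x := by
  obtain ⟨n, rfl | rfl⟩ := n.eq_nat_or_neg
  · rw [zpow_natCast, avgL_pow_map]
  · conv_rhs => rw [← show (ω ^ n) ((ω ^ (-(n : ℤ))) x) = x by
      rw [zpow_neg, zpow_natCast]; exact (ω ^ n).apply_symm_apply x]
    rw [avgL_pow_map]

variable [FiniteDimensional ℝ E] {Φ : Set E} {Δ : Finset E} {θ : E} {ω : E ≃ₗᵢ[ℝ] E}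

namespace IsFolding

variable (h : IsFolding Φ Δ θ ω) {α β : E}
include h

theorem pow_map_simple (hα : α ∈ Δ ∨ α = -θ) (n : ℕ) : (ω ^ n) α ∈ Δ ∨ (ω ^ n) α = -θ := by
  induction n with
  | zero => simpa using hα
  | succ n ih =>
    rw [pow_succ_apply]
    rcases ih with h' | h'
    · exact h.map_simple _ h'
    · rw [h']; exact h.map_neg_highest

theorem pow_map_mem_of_notMem_orbit (hα : α ∈ Δ) (hgood : -θ ∉ orbitOf ω α) (n : ℕ) :
    (ω ^ n) α ∈ Δ :=
  (h.pow_map_simple (Or.inl hα) n).resolve_right fun e => hgood ⟨n, by rw [zpow_natCast, e]⟩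

theorem ht_le_one (hα : α ∈ Δ ∨ α = -θ) : h.base.ht α ≤ 1 := by
  rcases hα with h' | rfl
  · exact (h.base.ht_simple h').le
  · rw [map_neg]
    linarith [h.ht_pos]

theorem ht_avgL_good (hα : α ∈ Δ) (hgood : -θ ∉ orbitOf ω α) : h.base.ht (avgL ω α) = 1 := by
  have h0 : (orderOf ω : ℝ) ≠ 0 := by exact_mod_cast h.orderOf_pos.ne'
  have e := congrArg h.base.ht (sum_pow_eq_smul_avgL h.orderOf_pos α)
  rw [map_sum, map_smul, smul_eq_mul, Finset.sum_congr rfl fun t _ =>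
    h.base.ht_simple (h.pow_map_mem_of_notMem_orbit hα hgood (t + 1))] at e
  simp only [Finset.sum_const, Finset.card_range, nsmul_eq_mul, mul_one] at e
  exact (mul_left_cancel₀ h0 (by rw [mul_one]; exact e)).symm

theorem ht_avgL_neg_highest_lt : h.base.ht (avgL ω (-θ)) < 1 := by
  have h0 : (0 : ℝ) < orderOf ω := by exact_mod_cast h.orderOf_pos
  have e := congrArg h.base.ht (sum_pow_eq_smul_avgL h.orderOf_pos (-θ))
  rw [map_sum, map_smul, smul_eq_mul] at e
  have hlt : ∑ t ∈ Finset.range (orderOf ω), h.base.ht ((ω ^ (t + 1)) (-θ)) <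
      ∑ t ∈ Finset.range (orderOf ω), (1 : ℝ) := by
    refine Finset.sum_lt_sum (fun t _ => h.ht_le_one (h.pow_map_simple (Or.inr rfl) _))
      ⟨orderOf ω - 1, Finset.mem_range.2 (Nat.sub_lt h.orderOf_pos one_pos), ?_⟩
    rw [Nat.sub_add_cancel (show 1 ≤ orderOf ω from h.orderOf_pos), pow_orderOf_eq_one]
    simp only [LinearIsometryEquiv.coe_one, id_eq, map_neg]
    linarith [h.ht_pos]
  rw [e] at hlt
  simp only [Finset.sum_const, Finset.card_range, nsmul_eq_mul, mul_one] at hlt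
  by_contra! hcon
  nlinarith

theorem defect_good (hα : α ∈ Δ) (hgood : -θ ∉ orbitOf ω α) : h.defect α = 0 := by
  rw [h.defect_apply, h.ht_avgL_good hα hgood, h.base.ht_simple hα, sub_self]

theorem defect_bad_pos (hα : α ∈ Δ) (hbad : -θ ∈ orbitOf ω α) : 0 < h.defect α := by
  obtain ⟨n, hn⟩ := hbad
  rw [h.defect_apply, ← avgL_zpow_map ω n α, hn, h.base.ht_simple hα]
  linarith [h.ht_avgL_neg_highest_lt]

theorem defect_nonneg (hα : α ∈ Δ) : 0 ≤ h.defect α := by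
  by_cases hbad : -θ ∈ orbitOf ω α
  · exact (h.defect_bad_pos hα hbad).le
  · exact (h.defect_good hα hbad).ge

theorem defect_highest_lt : h.defect θ < h.cox := by
  have := h.ht_avgL_neg_highest_lt
  rw [map_neg, map_neg] at this
  rw [h.defect_apply, cox]
  linarith

theorem defect_eq_sum (x : E) : h.defect x = ∑ α ∈ Δ, h.base.coord α x * h.defect α := by
  conv_lhs => rw [← h.base.sum_coord x]
  simp only [map_sum, map_smul, smul_eq_mul]

theorem coord_bad_eq_zero_of_pos (hβ : β ∈ Φ) (hpos : 0 < h.base.ht β)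
    (hdef : h.defect β ∈ AddSubgroup.zmultiples h.cox) (hα : α ∈ Δ) (hbad : -θ ∈ orbitOf ω α) :
    h.base.coord α β = 0 := by
  have hterm : ∀ γ ∈ Δ, 0 ≤ h.base.coord γ β * h.defect γ := fun γ hγ =>
    mul_nonneg (h.base.coord_nonneg hβ hpos hγ) (h.defect_nonneg hγ)
  have hnn : 0 ≤ h.defect β := by
    rw [h.defect_eq_sum]
    exact Finset.sum_nonneg hterm
  have hle : h.defect β ≤ h.defect θ := by
    rw [h.defect_eq_sum β, h.defect_eq_sum θ]
    exact Finset.sum_le_sum fun γ hγ =>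
      mul_le_mul_of_nonneg_right (h.coord_le hβ hγ) (h.defect_nonneg hγ)
  have hz : h.defect β = 0 := by
    obtain ⟨k, hk⟩ := AddSubgroup.mem_zmultiples_iff.1 hdef
    rw [zsmul_eq_mul] at hk
    have hc : 0 < h.cox := one_pos.trans h.one_lt_cox
    have h1 : (k : ℝ) < 1 := by
      by_contra! hcon
      nlinarith [h.defect_highest_lt]
    have h2 : (-1 : ℝ) < k := by
      by_contra! hcon
      nlinarith
    have h3 : k < 1 := by exact_mod_cast h1
    have h4 : -1 < k := by exact_mod_cast h2
    have h5 : k = 0 := by omega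
    rw [← hk, h5, Int.cast_zero, zero_mul]
  rw [h.defect_eq_sum, Finset.sum_eq_zero_iff_of_nonneg hterm] at hz
  exact (mul_eq_zero.1 (hz α hα)).resolve_right (h.defect_bad_pos hα hbad).ne.symm

/-- Every nonzero averaged root is the average of a root supported on the simple roots
whose orbit avoids `-θ`. -/
theorem exists_coord_bad_eq_zero (hβ : β ∈ Φ) (hne : avgL ω β ≠ 0) :
    ∃ β' ∈ Φ, avgL ω β' = avgL ω β ∧
      ∀ α ∈ Δ, -θ ∈ orbitOf ω α → h.base.coord α β' = 0 := by
  obtain ⟨β', hβ', heq, hdef⟩ := h.exists_defect_mem hβ hne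
  refine ⟨β', hβ', heq, fun α hα hbad => ?_⟩
  rcases lt_or_gt_of_ne (h.ht_ne_zero hβ') with h' | h'
  · have := h.coord_bad_eq_zero_of_pos (h.rs.neg_mem hβ') (by rw [map_neg]; linarith)
      (by rw [map_neg]; exact neg_mem hdef) hα hbad
    rwa [map_neg, neg_eq_zero] at this
  · exact h.coord_bad_eq_zero_of_pos hβ' h' hdef hα hbad

open Classical in
omit h [FiniteDimensional ℝ E] in
/-- The simple roots with orbit avoiding `-θ`. -/
noncomputable def goodRoots (Δ : Finset E) (θ : E) (ω : E ≃ₗᵢ[ℝ] E) : Finset E :=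
  Δ.filter fun α => -θ ∉ orbitOf ω α

omit h [FiniteDimensional ℝ E] in
theorem mem_goodRoots : α ∈ goodRoots Δ θ ω ↔ α ∈ Δ ∧ -θ ∉ orbitOf ω α := by
  classical
  exact Finset.mem_filter

omit h [FiniteDimensional ℝ E] in
theorem mem_simpleAvg {v : E} :
    v ∈ simpleAvg Δ θ ω ↔ ∃ α ∈ goodRoots Δ θ ω, avgL ω α = v := by
  simp only [simpleAvg, Set.mem_ofPred_eq, mem_goodRoots, avgL_apply, Finset.mem_coe, and_assoc]

/-- Averages of roots are integral combinations of averages of simple roots,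
with coefficients of constant sign. -/
theorem exists_intCoeff {v : E} (hv : v ∈ foldedRoots Φ ω) :
    ∃ (s : Finset E) (c : E → ℤ), ↑s ⊆ simpleAvg Δ θ ω ∧
      ((∀ u, 0 ≤ c u) ∨ (∀ u, c u ≤ 0)) ∧ v = ∑ u ∈ s, (c u : ℝ) • u := by
  classical
  obtain ⟨hv0, β, hβ, rfl⟩ := hv
  rw [← avgL_apply] at hv0 ⊢
  obtain ⟨β', hβ', heq, hcoord⟩ := h.exists_coord_bad_eq_zero hβ hv0
  have hfloor : ∀ α ∈ Δ, (⌊h.base.coord α β'⌋ : ℝ) = h.base.coord α β' := fun α hα => by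
    obtain ⟨n, hn⟩ := h.base.exists_coord_eq_intCast hβ' hα
    rw [hn, Int.floor_intCast]
  have hsum : avgL ω β' = ∑ α ∈ goodRoots Δ θ ω, h.base.coord α β' • avgL ω α := by
    conv_lhs => rw [← h.base.sum_coord β']
    simp only [map_sum, map_smul]
    refine (Finset.sum_subset (fun α hα => (mem_goodRoots.1 hα).1) fun α hα hn => ?_).symm
    rw [hcoord α hα, zero_smul]
    by_contra hbad
    exact hn (mem_goodRoots.2 ⟨hα, hbad⟩)
  refine ⟨(goodRoots Δ θ ω).image (avgL ω),
    fun u => ∑ α ∈ goodRoots Δ θ ω with avgL ω α = u, ⌊h.base.coord α β'⌋, ?_, ?_, ?_⟩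
  · intro u hu
    obtain ⟨α, hα, rfl⟩ := Finset.mem_image.1 hu
    exact mem_simpleAvg.2 ⟨α, hα, rfl⟩
  · have hmem : ∀ u, ∀ α ∈ (goodRoots Δ θ ω).filter (fun α => avgL ω α = u), α ∈ Δ :=
      fun u α hα => (mem_goodRoots.1 (Finset.mem_filter.1 hα).1).1
    refine (h.base.coord_nonneg_or_nonpos hβ').imp (fun hs u => ?_) (fun hs u => ?_)
    · exact Finset.sum_nonneg fun α hα => Int.floor_nonneg.2 (hs α (hmem u α hα))
    · refine Finset.sum_nonpos fun α hα => ?_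
      have h1 := hs α (hmem u α hα)
      rw [← hfloor α (hmem u α hα)] at h1
      exact_mod_cast h1
  · rw [← heq, hsum, ← Finset.sum_fiberwise_of_maps_to (g := avgL ω)
      (fun α hα => Finset.mem_image_of_mem _ hα)]
    refine Finset.sum_congr rfl fun u _ => ?_
    rw [Int.cast_sum, Finset.sum_smul]
    refine Finset.sum_congr rfl fun α hα => ?_
    obtain ⟨hα1, hα2⟩ := Finset.mem_filter.1 hα
    rw [hfloor α (mem_goodRoots.1 hα1).1, hα2]

open Classical in
omit h in
/-- The functional dual to an averaged simple root. -/
noncomputable def dualAvg (h : IsFolding Φ Δ θ ω) (v : E) : E →ₗ[ℝ] ℝ :=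
  ∑ α ∈ goodRoots Δ θ ω with avgL ω α = v, h.base.coord α

theorem dualAvg_simple {v : E} (hβ : β ∈ goodRoots Δ θ ω) [Decidable (avgL ω β = v)] :
    h.dualAvg v β = if avgL ω β = v then 1 else 0 := by
  classical
  have hβΔ := (mem_goodRoots.1 hβ).1
  rw [dualAvg, LinearMap.sum_apply]
  split_ifs with hv
  · rw [Finset.sum_eq_single β, h.base.coord_self hβΔ]
    · exact fun α _ hne => h.base.coord_of_ne hβΔ hne
    · exact fun hn => absurd (Finset.mem_filter.2 ⟨hβ, hv⟩) hn
  · refine Finset.sum_eq_zero fun α hα => h.base.coord_of_ne hβΔ ?_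
    rintro rfl
    exact hv (Finset.mem_filter.1 hα).2

theorem map_mem_goodRoots (hα : α ∈ goodRoots Δ θ ω) (n : ℕ) :
    (ω ^ n) α ∈ goodRoots Δ θ ω := by
  obtain ⟨h1, h2⟩ := mem_goodRoots.1 hα
  refine mem_goodRoots.2 ⟨h.pow_map_mem_of_notMem_orbit h1 h2 n, ?_⟩
  rintro ⟨t, ht⟩
  refine h2 ⟨t + n, ?_⟩
  rw [zpow_add, zpow_natCast]
  exact ht

theorem dualAvg_avg {v : E} (hβ : β ∈ goodRoots Δ θ ω) [Decidable (avgL ω β = v)] :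
    h.dualAvg v (avgL ω β) = if avgL ω β = v then 1 else 0 := by
  classical
  have h0 : (orderOf ω : ℝ) ≠ 0 := by exact_mod_cast h.orderOf_pos.ne'
  have e := congrArg (h.dualAvg v) (sum_pow_eq_smul_avgL h.orderOf_pos β)
  rw [map_sum, map_smul, smul_eq_mul, Finset.sum_congr rfl fun t _ =>
    (h.dualAvg_simple (h.map_mem_goodRoots hβ (t + 1)) (v := v))] at e
  simp only [avgL_pow_map, Finset.sum_const, Finset.card_range, nsmul_eq_mul] at e
  convert (mul_left_cancel₀ h0 e).symm

theorem dualAvg_self {v : E} (hv : v ∈ simpleAvg Δ θ ω) : h.dualAvg v v = 1 := by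
  classical
  obtain ⟨α, hα, rfl⟩ := mem_simpleAvg.1 hv
  rw [h.dualAvg_avg hα, if_pos rfl]

theorem dualAvg_of_ne {u v : E} (hu : u ∈ simpleAvg Δ θ ω) (hne : v ≠ u) :
    h.dualAvg v u = 0 := by
  classical
  obtain ⟨α, hα, rfl⟩ := mem_simpleAvg.1 hu
  rw [h.dualAvg_avg hα, if_neg hne.symm]

theorem linearIndependent_simpleAvg :
    LinearIndependent ℝ (fun v : simpleAvg Δ θ ω => (v : E)) :=
  LinearIndependent.of_pairwise_dual_eq_zero_one _ (fun v => h.dualAvg v)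
    (fun _ v hne => h.dualAvg_of_ne v.2 fun e => hne (Subtype.ext e))
    fun v => h.dualAvg_self v.2

omit [FiniteDimensional ℝ E] h in
theorem simpleAvg_subset_fixedSet : simpleAvg Δ θ ω ⊆ fixedSet ω := by
  intro v hv
  obtain ⟨α, -, rfl⟩ := mem_simpleAvg.1 hv
  exact map_avgL ω α

theorem span_simpleAvg : Submodule.span ℝ (simpleAvg Δ θ ω) = fixedSubmodule ω := by
  refine le_antisymm (Submodule.span_le.2 fun v hv => ?_) fun x hx => ?_
  · have : ω v = v := simpleAvg_subset_fixedSet hv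
    simpa [fixedSubmodule, sub_eq_zero] using this
  · have hfix : ω x = x := by simpa [fixedSubmodule, sub_eq_zero] using hx
    rw [← avgL_of_fixed h.orderOf_pos hfix, ← h.base.sum_coord x]
    simp only [map_sum, map_smul]
    refine sum_mem fun α hα => Submodule.smul_mem _ _ ?_
    by_cases h0 : avgL ω α = 0
    · rw [h0]; exact zero_mem _
    · obtain ⟨s, c, hs, -, e⟩ := h.exists_intCoeff (v := avgL ω α)
        ⟨h0, α, h.base.mem hα, (avgL_apply ω α).symm⟩
      rw [e]
      exact sum_mem fun u hu => Submodule.smul_mem _ _ (Submodule.subset_span (hs hu))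

theorem half_notMem_foldedRoots {u : E} (hu : u ∈ simpleAvg Δ θ ω) :
    (2⁻¹ : ℝ) • u ∉ foldedRoots Φ ω := by
  classical
  intro hmem
  obtain ⟨s, c, hs, -, e⟩ := h.exists_intCoeff hmem
  have e2 := congrArg (h.dualAvg u) e
  have hterm : ∀ w ∈ s, h.dualAvg u ((c w : ℝ) • w) = ((if u = w then c w else 0 : ℤ) : ℝ) := by
    intro w hw
    rw [map_smul, smul_eq_mul]
    split_ifs with huw
    · rw [← huw, h.dualAvg_self hu, mul_one]
    · rw [h.dualAvg_of_ne (hs hw) huw, mul_zero, Int.cast_zero]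
  rw [map_smul, h.dualAvg_self hu, map_sum, Finset.sum_congr rfl hterm, ← Int.cast_sum] at e2
  set k : ℤ := ∑ w ∈ s, if u = w then c w else 0
  have h2 : (1 : ℝ) = 2 * k := by
    rw [← e2]; norm_num
  have h3 : (1 : ℤ) = 2 * k := by exact_mod_cast h2
  omega

end IsFolding

end SimpleAverages

end Folding

open Folding

theorem folded_simple_roots_form_base
    {E : Type*} [NormedAddCommGroup E] [InnerProductSpace ℝ E] [FiniteDimensional ℝ E]
    (Φ : Set E) (Δ : Finset E) (coeff : E → E → ℝ) (htilde : E) (ω : E ≃ₗᵢ[ℝ] E)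
    (hΦrs : IsRootSystem Φ) (hΦred : IsReducedRS Φ) (hΦirr : IsIrreducibleRS Φ)
    (hΔ : IsBaseRS Φ Δ)
    (hcoeff : ∀ β ∈ Φ, β = ∑ α ∈ Δ, coeff β α • α)
    (hht : htilde ∈ Φ)
    (hhighest : ∀ β ∈ Φ, β ≠ htilde → ∑ α ∈ Δ, coeff β α < ∑ α ∈ Δ, coeff htilde α)
    (hωW : InWeylGroup Φ ω)
    (hωΔ₀ : ⇑ω '' (↑Δ ∪ {-htilde}) = ↑Δ ∪ {-htilde}) :
    simpleAvg Δ htilde ω ⊆ fixedSet ω ∧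
      LinearIndependent ℝ (fun v : simpleAvg Δ htilde ω => (v : E)) ∧
      Submodule.span ℝ (simpleAvg Δ htilde ω) = fixedSubmodule ω ∧
      (∀ v ∈ foldedRoots Φ ω, ∃ (s : Finset E) (c : E → ℤ),
        ↑s ⊆ simpleAvg Δ htilde ω ∧ ((∀ u, 0 ≤ c u) ∨ (∀ u, c u ≤ 0)) ∧
        v = ∑ u ∈ s, (c u : ℝ) • u) ∧
      ∀ u ∈ simpleAvg Δ htilde ω, (2⁻¹ : ℝ) • u ∉ foldedRoots Φ ω := by
  have hcoord : ∀ β ∈ Φ, hΔ.ht β = ∑ α ∈ Δ, coeff β α := fun β hβ => by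
    rw [hΔ.ht_apply]
    refine Finset.sum_congr rfl fun α hα => ?_
    conv_lhs => rw [hcoeff β hβ]
    exact hΔ.coord_sum (coeff β) hα
  have hmaps : ∀ x ∈ (↑Δ ∪ {-htilde} : Set E), ω x ∈ Δ ∨ ω x = -htilde := fun x hx => by
    have : ω x ∈ (↑Δ ∪ {-htilde} : Set E) := by
      rw [← hωΔ₀]
      exact Set.mem_image_of_mem ω hx
    exact this
  have h : IsFolding Φ Δ htilde ω :=
    { rs := hΦrs
      red := hΦred
      base := hΔ
      irr := hΦirr
      mem := hht
      ht_lt := fun β hβ hne => by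
        rw [hcoord β hβ, hcoord htilde hht]
        exact hhighest β hβ hne
      mem_reflGroup := hωW.mem_reflGroup
      map_simple := fun α hα => hmaps α (Or.inl hα)
      map_neg_highest := hmaps _ (Or.inr rfl) }
  exact ⟨IsFolding.simpleAvg_subset_fixedSet, h.linearIndependent_simpleAvg, h.span_simpleAvg,
    fun v hv => h.exists_intCoeff hv, fun u hu => h.half_notMem_foldedRoots hu⟩
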